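/- arXiv:1808.07393 — 4 statements merged into one kernel-verified Lean document; each statement's English description precedes it below -/
import Mathlib

section
/- Let 0 ≤ α < 1 and let f(z) = z·h(z)·conj(g(z)) belong to S*_Lh(α). Then for all z ∈ 𝔻: (1/(1+|z|))·exp(−2(1−α)|z|/(1+|z|)) ≤ |h(z)| ≤ (1/(1−|z|))·exp(2(1−α)|z|/(1−|z|)). -/
open Complex Metric

lemma aux_schwarz (q : ℂ → ℂ) (R : ℝ) (hR : 1 < R) (hq : DifferentiableOn ℂ q (ball 0 R))
    (z : ℂ) (hz : ‖z‖ < 1) :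
    Real.circleAverage (fun ζ => ((q ζ).re : ℂ) * (2 * ζ / (ζ - z))) 0 1
      = q z + (starRingEnd ℂ) (q 0) := by
  have hsub : closedBall (0:ℂ) 1 ⊆ ball 0 R := closedBall_subset_ball hR
  have hcl : closure (ball (0:ℂ) 1) = closedBall 0 1 := closure_ball 0 one_ne_zero
  have hd : DiffContOnCl ℂ q (ball 0 |1|) := by
    apply DifferentiableOn.diffContOnCl
    rw [abs_one, hcl]; exact hq.mono hsub
  have hne : ∀ ζ : ℂ, ‖ζ‖ ≤ 1 → 1 - ζ * (starRingEnd ℂ) z ≠ 0 := by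
    intro ζ hζ h0
    have h1 : ‖ζ * (starRingEnd ℂ) z‖ = 1 := by rw [← sub_eq_zero.1 h0]; simp
    rw [norm_mul, RCLike.norm_conj] at h1
    nlinarith [norm_nonneg ζ, norm_nonneg z]
  have hne2 : ∀ ζ : ℂ, ‖ζ‖ = 1 → ζ - z ≠ 0 := by
    intro ζ hζ h0
    rw [sub_eq_zero.1 h0] at hζ; linarith
  have hqs : ContinuousOn q (sphere 0 1) :=
    hq.continuousOn.mono (sphere_subset_closedBall.trans hsub)
  have e1 : Real.circleAverage (fun ζ => (ζ / (ζ - z)) • q ζ) 0 1 = q z := by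
    have := hd.circleAverage_smul_div (w := z) (by simpa using hz)
    simpa using this
  have hd2 : DiffContOnCl ℂ (fun ζ => q ζ * (1 - ζ * (starRingEnd ℂ) z)⁻¹) (ball 0 |1|) := by
    apply DifferentiableOn.diffContOnCl
    rw [abs_one, hcl]
    apply (hq.mono hsub).mul
    apply DifferentiableOn.inv (by fun_prop)
    intro ζ hζ; exact hne ζ (by simpa using hζ)
  have e2 := hd2.circleAverage
  simp only [zero_mul, sub_zero, inv_one, mul_one] at e2
  have hci : CircleIntegrable (fun ζ => q ζ * (1 - ζ * (starRingEnd ℂ) z)⁻¹) 0 1 := by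
    apply ContinuousOn.circleIntegrable zero_le_one
    apply hqs.mul
    apply ContinuousOn.inv₀ (by fun_prop)
    intro ζ hζ; exact hne ζ (by simp at hζ; exact hζ.le)
  have e3 := (conjCLE : ℂ →L[ℝ] ℂ).circleAverage_comp_comm hci
  rw [e2] at e3
  have hc1 : CircleIntegrable (fun ζ => (ζ / (ζ - z)) • q ζ) 0 1 := by
    apply ContinuousOn.circleIntegrable zero_le_one
    have hk : ContinuousOn (fun ζ : ℂ => ζ / (ζ - z)) (sphere 0 1) := by
      apply ContinuousOn.div (by fun_prop) (by fun_prop)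
      intro ζ hζ; exact hne2 ζ (by simpa using hζ)
    exact hk.smul hqs
  have hc2 : CircleIntegrable ((conjCLE : ℂ →L[ℝ] ℂ) ∘
      (fun ζ => q ζ * (1 - ζ * (starRingEnd ℂ) z)⁻¹)) 0 1 := by
    apply ContinuousOn.circleIntegrable zero_le_one
    apply (ContinuousLinearMap.continuous _).comp_continuousOn
    apply hqs.mul
    apply ContinuousOn.inv₀ (by fun_prop)
    intro ζ hζ; exact hne ζ (by simp at hζ; exact hζ.le)
  have e4 := Real.circleAverage_add hc1 hc2
  rw [e1, e3] at e4
  simp only [ContinuousLinearEquiv.coe_coe, conjCLE_apply] at e4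
  rw [← e4]
  apply Real.circleAverage_congr_sphere
  intro ζ hζ
  have hζ1 : ‖ζ‖ = 1 := by simpa using hζ
  have hζ0 : ζ ≠ 0 := by intro h; simp [h] at hζ1
  have hz1 := hne2 ζ hζ1
  have hcz : (starRingEnd ℂ) ζ = ζ⁻¹ := by
    rw [inv_def, normSq_eq_norm_sq, hζ1]; simp
  simp only [Pi.add_apply, Function.comp, conjCLE_apply,
    map_mul, map_inv₀, map_sub, map_one, Complex.conj_conj, hcz, smul_eq_mul]
  have h3 : (1 - ζ⁻¹ * z)⁻¹ = ζ / (ζ - z) := by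
    have : 1 - ζ⁻¹ * z = (ζ - z) / ζ := by field_simp
    rw [this, inv_div]
  rw [h3, re_eq_add_conj]
  ring

lemma aux_dslope (q : ℂ → ℂ) (R : ℝ) (hR : 1 < R) (hq : DifferentiableOn ℂ q (ball 0 R))
    (hq0 : q 0 = 1) (z : ℂ) (hz : ‖z‖ < 1) (hz0 : z ≠ 0) :
    Real.circleAverage (fun ζ => ((q ζ).re : ℂ) * (2 / (ζ - z))) 0 1 = dslope q 0 z := by
  have h1 := aux_schwarz q R hR hq z hz
  have h2 := aux_schwarz q R hR hq 0 (by simp)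
  have hsub : closedBall (0:ℂ) 1 ⊆ ball 0 R := closedBall_subset_ball hR
  have hqs : ContinuousOn q (sphere 0 1) :=
    hq.continuousOn.mono (sphere_subset_closedBall.trans hsub)
  have hne2 : ∀ w ζ : ℂ, ‖w‖ < 1 → ‖ζ‖ = 1 → ζ - w ≠ 0 := by
    intro w ζ hw hζ h0
    rw [sub_eq_zero.1 h0] at hζ; linarith
  have hci : ∀ w : ℂ, ‖w‖ < 1 → CircleIntegrable (fun ζ => ((q ζ).re : ℂ) * (2 * ζ / (ζ - w))) 0 1 := by
    intro w hw
    apply ContinuousOn.circleIntegrable zero_le_one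
    apply ContinuousOn.mul
    · exact continuous_ofReal.comp_continuousOn (continuous_re.comp_continuousOn hqs)
    apply ContinuousOn.div (by fun_prop) (by fun_prop)
    intro ζ hζ; exact hne2 w ζ hw (by simpa using hζ)
  have h3 := Real.circleAverage_sub (hci z hz) (hci 0 (by simp))
  rw [h1, h2, hq0] at h3
  rw [dslope_of_ne _ hz0, slope_def_module, hq0]
  have h4 : (q z - 1) = q z + (starRingEnd ℂ) 1 - (1 + (starRingEnd ℂ) 1) := by simp
  rw [h4, ← h3, ← Real.circleAverage_smul]
  apply Real.circleAverage_congr_sphere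
  intro ζ hζ
  have hζ1 : ‖ζ‖ = 1 := by simpa using hζ
  have hζ0 : ζ ≠ 0 := by intro h; simp [h] at hζ1
  have hz1 := hne2 z ζ hz hζ1
  simp only [Pi.sub_apply, Pi.smul_apply, smul_eq_mul, sub_zero]
  field_simp
  ring

lemma aux_A (q : ℂ → ℂ) (R : ℝ) (hR : 1 < R) (hq : DifferentiableOn ℂ q (ball 0 R))
    (hq0 : q 0 = 1) (hre : ∀ z ∈ ball (0:ℂ) R, 0 < (q z).re)
    (r : ℝ) (hr0 : 0 ≤ r) (hr1 : r < 1) (φ : ℝ → ℂ) (hφ : ContinuousOn φ (Set.Icc 0 r)) (C : ℝ)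
    (hC : ∀ η : ℂ, ‖η‖ = 1 → C ≤ ∫ t in (0:ℝ)..r, (φ t * (2 * η / (1 - η * t))).re) :
    C ≤ ∫ t in (0:ℝ)..r, (φ t * dslope q 0 t).re := by
  have hsub : closedBall (0:ℂ) 1 ⊆ ball 0 R := closedBall_subset_ball hR
  set c : ℝ → ℂ := circleMap 0 1 with hc
  have hcc : Continuous c := continuous_circleMap 0 1
  have hcn : ∀ θ, ‖c θ‖ = 1 := by intro θ; simp [hc]
  have hqc : Continuous (fun θ => q (c θ)) := by
    apply hq.continuousOn.comp_continuous hcc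
    intro θ; apply hsub; simp [hcn]
  have hcne : ∀ θ (t : ℝ), t ∈ Set.Icc 0 r → c θ - t ≠ 0 := by
    intro θ t ht h0
    have := hcn θ
    rw [sub_eq_zero.1 h0] at this
    rw [norm_real, Real.norm_eq_abs, abs_of_nonneg ht.1] at this
    linarith [ht.2]
  set F : ℝ → ℝ → ℝ := fun t θ => (q (c θ)).re * (φ t * (2 / (c θ - t))).re with hF
  have hFc : ContinuousOn (Function.uncurry F) (Set.Icc 0 r ×ˢ Set.Icc 0 (2 * Real.pi)) := by
    have hqc2 : Continuous (fun x : ℝ × ℝ => (q (c x.2)).re) :=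
      continuous_re.comp (hqc.comp continuous_snd)
    apply hqc2.continuousOn.mul
    apply continuous_re.comp_continuousOn
    apply ContinuousOn.mul
    · exact hφ.comp continuousOn_fst (fun x hx => hx.1)
    · apply ContinuousOn.div (by fun_prop)
      · exact ((hcc.comp continuous_snd).sub (continuous_ofReal.comp continuous_fst)).continuousOn
      · intro x hx; exact hcne _ _ hx.1
  have hFi : MeasureTheory.IntegrableOn (Function.uncurry F)
      (Set.Icc 0 r ×ˢ Set.Icc 0 (2 * Real.pi)) :=
    hFc.integrableOn_compact (isCompact_Icc.prod isCompact_Icc)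
  have hpi : (0:ℝ) ≤ 2 * Real.pi := by positivity
  have hFi2 : MeasureTheory.Integrable (Function.uncurry F)
      ((MeasureTheory.volume.restrict (Set.Ioc 0 r)).prod
        (MeasureTheory.volume.restrict (Set.Ioc 0 (2 * Real.pi)))) := by
    rw [MeasureTheory.Measure.prod_restrict]
    exact hFi.mono_set (Set.prod_mono Set.Ioc_subset_Icc_self Set.Ioc_subset_Icc_self)
  have hswap : ∫ t in (0:ℝ)..r, ∫ θ in (0:ℝ)..2 * Real.pi, F t θ
      = ∫ θ in (0:ℝ)..2 * Real.pi, ∫ t in (0:ℝ)..r, F t θ := by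
    simp only [intervalIntegral.integral_of_le hr0, intervalIntegral.integral_of_le hpi]
    exact MeasureTheory.integral_integral_swap hFi2
  have hw : (2 * Real.pi)⁻¹ * ∫ θ in (0:ℝ)..2 * Real.pi, (q (c θ)).re = 1 := by
    have h2 := aux_schwarz q R hR hq 0 (by simp)
    have h3 : Real.circleAverage (fun ζ => ((q ζ).re : ℂ) * (2 * ζ / (ζ - 0))) 0 1
        = Real.circleAverage (fun ζ => (((2 * (q ζ).re : ℝ)) : ℂ)) 0 1 := by
      apply Real.circleAverage_congr_sphere
      intro ζ hζ
      have hζ1 : ‖ζ‖ = 1 := by simpa using hζ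
      have hζ0 : ζ ≠ 0 := by intro h; simp [h] at hζ1
      simp; field_simp
    rw [h3, hq0, Real.circleAverage_def, intervalIntegral.integral_ofReal,
      intervalIntegral.integral_const_mul] at h2
    have h4 := congrArg Complex.re h2
    simp at h4
    simp only [hc] 
    rw [mul_inv]
    linarith
  have hrep : ∫ t in (0:ℝ)..r, (φ t * dslope q 0 t).re
      = (2 * Real.pi)⁻¹ * ∫ t in (0:ℝ)..r, ∫ θ in (0:ℝ)..2 * Real.pi, F t θ := by
    rw [← intervalIntegral.integral_const_mul]
    apply intervalIntegral.integral_congr_ae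
    refine Filter.Eventually.of_forall fun t ht => ?_
    rw [Set.uIoc_of_le hr0] at ht
    have htt : t ∈ Set.Icc 0 r := Set.Ioc_subset_Icc_self ht
    rw [← aux_dslope q R hR hq hq0 t (by rw [norm_real, Real.norm_eq_abs, abs_of_pos ht.1]; linarith [ht.2])
      (by exact_mod_cast ht.1.ne'), Real.circleAverage_def, mul_smul_comm, ← intervalIntegral.integral_const_mul]
    rw [real_smul, re_ofReal_mul]
    congr 1
    have hcont : Continuous (fun θ => φ t * (((q (c θ)).re : ℂ) * (2 / (c θ - t)))) := by
      apply continuous_const.mul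
      apply (continuous_ofReal.comp (continuous_re.comp hqc)).mul
      apply Continuous.div continuous_const (by fun_prop)
      intro θ; exact hcne θ t htt
    have := (reCLM).intervalIntegral_comp_comm (hcont.intervalIntegrable (μ := MeasureTheory.volume) 0 (2 * Real.pi))
    simp only [reCLM_apply] at this
    rw [← this]
    apply intervalIntegral.integral_congr
    intro θ _
    simp only [hF]
    rw [← re_ofReal_mul]; congr 1; ring
  rw [hrep, hswap]
  have hmono : ∫ θ in (0:ℝ)..2 * Real.pi, (q (c θ)).re * C
      ≤ ∫ θ in (0:ℝ)..2 * Real.pi, ∫ t in (0:ℝ)..r, F t θ := by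
    apply intervalIntegral.integral_mono_on hpi
    · exact ((continuous_re.comp hqc).mul continuous_const).intervalIntegrable _ _
    · rw [intervalIntegrable_iff_integrableOn_Ioc_of_le hpi]
      simp only [intervalIntegral.integral_of_le hr0]
      exact hFi2.integral_prod_right
    · intro θ _
      simp only [hF]
      rw [intervalIntegral.integral_const_mul]
      apply mul_le_mul_of_nonneg_left _ (hre _ (hsub (by simp [hcn]))).le
      refine (hC (c θ)⁻¹ (by simp [hcn])).trans (le_of_eq ?_)
      apply intervalIntegral.integral_congr
      intro t ht
      rw [Set.uIcc_of_le hr0] at ht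
      have h1 := hcne θ t ht
      have h0 : c θ ≠ 0 := by intro h; have := hcn θ; simp [h] at this
      have h3 : 1 - (c θ)⁻¹ * t = (c θ - t) / c θ := by field_simp
      simp only []
      rw [h3]; congr 2; field_simp
  rw [intervalIntegral.integral_mul_const] at hmono
  have := mul_le_mul_of_nonneg_left hmono (inv_nonneg.2 hpi)
  rwa [← mul_assoc, hw, one_mul] at this

lemma aux_ftc (f f' : ℝ → ℂ) (r : ℝ) (hr0 : 0 ≤ r)
    (hd : ∀ t ∈ Set.Icc 0 r, HasDerivAt f (f' t) t) (hc : ContinuousOn f' (Set.Icc 0 r)) :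
    ∫ t in (0:ℝ)..r, (f' t).re = (f r).re - (f 0).re := by
  have hi : IntervalIntegrable f' MeasureTheory.volume 0 r := by
    apply ContinuousOn.intervalIntegrable; rwa [Set.uIcc_of_le hr0]
  have h1 := intervalIntegral.integral_eq_sub_of_hasDerivAt
    (by rw [Set.uIcc_of_le hr0]; exact hd) hi
  have h2 := reCLM.intervalIntegral_comp_comm hi
  simp only [reCLM_apply] at h2
  rw [h2, h1, sub_re]

lemma aux_re (w : ℂ) (r : ℝ) (hw : ‖w‖ = r) (hr : r < 1) :
    -(r / (1 + r)) ≤ (w / (1 - w)).re := by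
  have hr0 : 0 ≤ r := hw ▸ norm_nonneg w
  have hx : -r ≤ w.re := by rw [← hw]; exact (abs_le.1 (abs_re_le_norm w)).1
  have hn : w.re * w.re + w.im * w.im = r ^ 2 := by
    rw [← hw, ← normSq_eq_norm_sq, normSq_apply]
  have hx2 : w.re ≤ r := by rw [← hw]; exact re_le_norm w
  have hpos : 0 < (1 - w.re) * (1 - w.re) + w.im * w.im := by nlinarith
  have : (w / (1 - w)).re = (w.re - r ^ 2) / ((1 - w.re) * (1 - w.re) + w.im * w.im) := by
    rw [div_re, normSq_apply]
    simp only [sub_re, sub_im, one_re, one_im, zero_sub]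
    rw [← hn]
    have : (1 - w.re) * (1 - w.re) + -w.im * -w.im ≠ 0 := by nlinarith
    field_simp; ring
  rw [this, ← neg_div, div_le_div_iff₀ (by linarith) hpos]
  nlinarith [mul_nonneg (by linarith : 0 ≤ r + w.re) (by linarith : 0 ≤ 1 - r)]

lemma aux_slit (w : ℂ) (hw : ‖w‖ < 1) : 1 - w ∈ slitPlane := by
  left; simp only [sub_re, one_re]; linarith [re_le_norm w]

lemma aux_mono (r : ℝ) (hr0 : 0 ≤ r) (hr : r < 1) :
    Monotone (fun θ : ℝ => θ * (r / (1 + r)) - (Complex.log (1 - r * cexp (θ * I))).im) := by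
  have hd : ∀ θ : ℝ, HasDerivAt
      (fun θ : ℝ => θ * (r / (1 + r)) - (Complex.log (1 - r * cexp (θ * I))).im)
      (r / (1 + r) + ((r * cexp (θ * I)) / (1 - r * cexp (θ * I))).re) θ := by
    intro θ
    have hn : ‖(r : ℂ) * cexp (θ * I)‖ = r := by simp [abs_of_nonneg hr0]
    have h1 : HasDerivAt (fun θ : ℝ => (1:ℂ) - r * cexp (θ * I)) (-(r * (cexp (θ * I) * I))) θ := by
      have : HasDerivAt (fun θ : ℝ => (θ : ℂ) * I) I θ := by
        simpa using (hasDerivAt_id θ).ofReal_comp.mul_const I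
      exact (this.cexp.const_mul (r:ℂ)).const_sub 1
    have h2 := h1.clog_real (aux_slit _ (by rw [hn]; exact hr))
    have h3 := imCLM.hasFDerivAt.comp_hasDerivAt θ h2
    have h4 := ((hasDerivAt_id θ).mul_const (r / (1 + r))).sub h3
    refine h4.congr_deriv ?_
    simp only [imCLM_apply, one_mul]
    have : -((r:ℂ) * (cexp (θ * I) * I)) / (1 - r * cexp (θ * I))
        = -(((r * cexp (θ * I)) / (1 - r * cexp (θ * I))) * I) := by ring
    rw [this, neg_im, mul_I_im]; ring
  apply monotone_of_deriv_nonneg (fun θ => (hd θ).differentiableAt)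
  intro θ
  rw [(hd θ).deriv]
  have := aux_re ((r : ℂ) * cexp (θ * I)) r (by simp [abs_of_nonneg hr0]) hr
  linarith

lemma aux_xcos (x : ℝ) (h0 : 0 < x) (h1 : x ≤ Real.pi / 2) : x * Real.cos x ≤ Real.sin x := by
  rcases h1.lt_or_eq with h | h
  · have hc : 0 < Real.cos x := Real.cos_pos_of_mem_Ioo ⟨by linarith, h⟩
    have := Real.lt_tan h0 h
    rw [Real.tan_eq_sin_div_cos, lt_div_iff₀ hc] at this
    exact this.le
  · rw [h]; simp

lemma aux_cot (r : ℝ) (hr0 : 0 ≤ r) (hr : r < 1) (a x : ℝ) (hx0 : x ≠ 0)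
    (hx1 : -(Real.pi / 2) < x) (hx2 : x ≤ Real.pi / 2) :
    Real.cos x / Real.sin x * ((Complex.log (1 - r * cexp ((a + 2 * x : ℝ) * I))).im
      - (Complex.log (1 - r * cexp (a * I))).im) ≤ 2 * r / (1 + r) := by
  have hm := aux_mono r hr0 hr
  set k := r / (1 + r) with hk
  have hk0 : 0 ≤ k := by positivity
  have hk2 : 2 * r / (1 + r) = 2 * k := by rw [hk]; ring
  rw [hk2]
  have hcos : 0 ≤ Real.cos x := Real.cos_nonneg_of_mem_Icc ⟨hx1.le, hx2⟩
  rcases lt_or_gt_of_ne hx0 with h | h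
  · have h1 := hm (show a + 2 * x ≤ a by linarith)
    simp only at h1
    have hs : 0 < Real.sin (-x) := Real.sin_pos_of_pos_of_lt_pi (by linarith) (by linarith [Real.pi_pos])
    have h2 := aux_xcos (-x) (by linarith) (by linarith)
    rw [Real.sin_neg] at hs h2
    rw [Real.cos_neg] at h2
    rw [← neg_div_neg_eq]
    rw [div_mul_eq_mul_div, div_le_iff₀ hs]
    nlinarith [mul_nonneg hcos hk0]
  · have h1 := hm (show a ≤ a + 2 * x by linarith)
    simp only at h1
    have hs : 0 < Real.sin x := Real.sin_pos_of_pos_of_lt_pi h (by linarith [Real.pi_pos])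
    have h2 := aux_xcos x h hx2
    rw [div_mul_eq_mul_div, div_le_iff₀ hs]
    nlinarith [mul_nonneg hcos hk0]

lemma aux_ne (η : ℂ) (hη : ‖η‖ = 1) (r t : ℝ) (hr : r < 1) (ht : t ∈ Set.Icc 0 r) :
    ‖η * t‖ < 1 := by
  rw [norm_mul, hη, one_mul, norm_real, Real.norm_eq_abs, abs_of_nonneg ht.1]
  exact ht.2.trans_lt hr

lemma aux_ne' (η : ℂ) (hη : ‖η‖ = 1) (r t : ℝ) (hr : r < 1) (ht : t ∈ Set.Icc 0 r) :
    1 - η * t ≠ 0 := slitPlane_ne_zero (aux_slit _ (aux_ne η hη r t hr ht))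

lemma aux_logd (η : ℂ) (hη : ‖η‖ = 1) (r t : ℝ) (hr : r < 1) (ht : t ∈ Set.Icc 0 r) :
    HasDerivAt (fun t : ℝ => Complex.log (1 - η * t)) (-η / (1 - η * t)) t := by
  have h1 : HasDerivAt (fun t : ℝ => 1 - η * (t:ℂ)) (-η) t := by
    simpa using ((hasDerivAt_id t).ofReal_comp.const_mul η).const_sub 1
  exact h1.clog_real (aux_slit _ (aux_ne η hη r t hr ht))

lemma aux_cont (η : ℂ) (hη : ‖η‖ = 1) (r : ℝ) (hr : r < 1) :
    ContinuousOn (fun t : ℝ => (1 - η * t)⁻¹) (Set.Icc 0 r) := by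
  apply ContinuousOn.inv₀ (by fun_prop)
  intro t ht; exact aux_ne' η hη r t hr ht

lemma aux_int1 (ζ : ℂ) (hζ : ‖ζ‖ = 1) (r : ℝ) (hr0 : 0 ≤ r) (hr : r < 1) :
    ∫ t in (0:ℝ)..r, (ζ / (1 - ζ * t)).re = -(Complex.log (1 - ζ * r)).re := by
  rw [aux_ftc (fun t : ℝ => - Complex.log (1 - ζ * t)) _ r hr0]
  · simp
  · intro t ht
    have := (aux_logd ζ hζ r t hr ht).neg
    exact this.congr_deriv (by ring)
  · simp only [div_eq_mul_inv]
    exact continuousOn_const.mul (aux_cont ζ hζ r hr)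

lemma aux_kernel (η ζ : ℂ) (hη : ‖η‖ = 1) (hζ : ‖ζ‖ = 1) (r : ℝ) (hr0 : 0 ≤ r) (hr : r < 1) :
    -Real.log (1 + r) - 2 * r / (1 + r) ≤
      (∫ t in (0:ℝ)..r, (2 * η / ((1 - η * t) * (1 - ζ * t))).re)
        - (Complex.log (1 - ζ * r)).re := by
  have hrr : r ∈ Set.Icc 0 r := ⟨hr0, le_rfl⟩
  have hcont : ContinuousOn (fun t : ℝ => 2 * η / ((1 - η * t) * (1 - ζ * t))) (Set.Icc 0 r) := by
    simp only [div_eq_mul_inv, mul_inv]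
    exact continuousOn_const.mul ((aux_cont η hη r hr).mul (aux_cont ζ hζ r hr))
  have hlog : ∀ η : ℂ, ‖η‖ = 1 → (Complex.log (1 - η * r)).re ≤ Real.log (1 + r) := by
    intro η hη
    rw [log_re]
    apply Real.log_le_log (norm_pos_iff.2 (aux_ne' η hη r r hr hrr))
    refine (norm_sub_le _ _).trans ?_
    rw [norm_mul, hη, norm_real, Real.norm_eq_abs, abs_of_nonneg hr0]; simp
  by_cases he : η = ζ
  · subst he
    rw [aux_ftc (fun t : ℝ => 2 * ((η * t) / (1 - η * t))) _ r hr0 _ hcont]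
    · have h1 := aux_re (η * r) r (by rw [norm_mul, hη, norm_real, Real.norm_eq_abs, abs_of_nonneg hr0]; simp) hr
      have h2 := hlog η hη
      have h3 : (2 * ((η * r) / (1 - η * r))).re = 2 * ((η * r) / (1 - η * r)).re := by
        simp [mul_re]
      rw [h3]
      have h4 : 2 * r / (1 + r) = 2 * (r / (1 + r)) := by ring
      rw [h4]
      simp
      linarith
    · intro t ht
      have h0 := aux_ne' η hη r t hr ht
      have ha : HasDerivAt (fun t : ℝ => η * (t:ℂ)) η t := by
        simpa using ((hasDerivAt_id t).ofReal_comp.const_mul η)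
      have := (ha.div (ha.const_sub 1) h0).const_mul 2
      refine this.congr_deriv ?_
      field_simp
      ring
  · have hsub : η - ζ ≠ 0 := sub_ne_zero.2 he
    rw [aux_ftc (fun t : ℝ => 2 * η / (η - ζ) * (Complex.log (1 - ζ * t) - Complex.log (1 - η * t)))
      _ r hr0 _ hcont]
    · set a := η.arg
      set x := (ζ / η).arg / 2 with hx
      have hη0 : η ≠ 0 := by intro h; simp [h] at hη
      have ha : η = cexp (a * I) := by
        have := norm_mul_exp_arg_mul_I η
        rw [hη] at this; simpa using this.symm
      have hd : ζ / η = cexp ((2 * x : ℝ) * I) := by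
        have := norm_mul_exp_arg_mul_I (ζ / η)
        rw [norm_div, hη, hζ] at this
        have e : 2 * x = (ζ / η).arg := by rw [hx]; ring
        rw [e]; simpa using this.symm
      have hb : ζ = cexp ((a + 2 * x : ℝ) * I) := by
        have : ζ = η * (ζ / η) := by field_simp
        rw [this, hd]
        conv_lhs => rw [ha]
        rw [← Complex.exp_add]; congr 1; push_cast; ring
      have hx0 : x ≠ 0 := by
        intro h0
        rw [h0] at hd
        simp at hd
        rw [div_eq_one_iff_eq hη0] at hd
        exact he hd.symm
      have hx1 : -(Real.pi / 2) < x := by have := neg_pi_lt_arg (ζ / η); rw [hx]; linarith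
      have hx2 : x ≤ Real.pi / 2 := by have := arg_le_pi (ζ / η); rw [hx]; linarith
      have hs : Real.sin x ≠ 0 := by
        rw [Ne, Real.sin_eq_zero_iff_of_lt_of_lt (by linarith [Real.pi_pos]) (by linarith [Real.pi_pos])]
        exact hx0
      have hA : 2 * η / (η - ζ) = 1 + ((Real.cos x / Real.sin x : ℝ) : ℂ) * I := by
        rw [div_eq_iff hsub]
        have e1 : ζ = η * (ζ / η) := by field_simp
        have e2 : ζ / η = (Real.cos x + Real.sin x * I) ^ 2 := by
          rw [hd, ofReal_cos, ofReal_sin, ← exp_mul_I, ← Complex.exp_nat_mul]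
          congr 1; push_cast; ring
        have hs' : (Real.sin x : ℂ) ≠ 0 := by exact_mod_cast hs
        have hcs : (Real.cos x : ℂ) ^ 2 + (Real.sin x : ℂ) ^ 2 = 1 := by
          exact_mod_cast Real.cos_sq_add_sin_sq x
        rw [e1, e2, ofReal_div]
        generalize (Real.cos x : ℂ) = C at *
        generalize (Real.sin x : ℂ) = S at *
        field_simp
        have hI : I ^ 2 = -1 := I_sq
        have hC : C ^ 2 = 1 - S ^ 2 := by linear_combination hcs
        linear_combination (2 * S * C ^ 2 + S ^ 2 * C * I + S ^ 3) * hI + (I * C - S) * hcs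
      have hcot := aux_cot r hr0 hr a x hx0 hx1 hx2
      rw [← ha, ← hb, mul_comm (r:ℂ), mul_comm (r:ℂ)] at hcot
      have h2 := hlog η hη
      rw [hA]
      have e3 : ((1 + ((Real.cos x / Real.sin x : ℝ) : ℂ) * I) *
          (Complex.log (1 - ζ * r) - Complex.log (1 - η * r))).re =
          (Complex.log (1 - ζ * r)).re - (Complex.log (1 - η * r)).re
          - Real.cos x / Real.sin x * ((Complex.log (1 - ζ * r)).im - (Complex.log (1 - η * r)).im) := by
        rw [mul_re]
        simp only [add_re, one_re, add_im, one_im, re_ofReal_mul, im_ofReal_mul, I_re, I_im, sub_re, sub_im]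
        ring
      rw [e3]
      simp
      linarith
    · intro t ht
      have h0 := aux_ne' η hη r t hr ht
      have h1 := aux_ne' ζ hζ r t hr ht
      have := ((aux_logd ζ hζ r t hr ht).sub (aux_logd η hη r t hr ht)).const_mul (2 * η / (η - ζ))
      refine this.congr_deriv ?_
      field_simp
      ring

lemma aux_dsc (q : ℂ → ℂ) (R : ℝ) (hR : 1 < R) (hq : DifferentiableOn ℂ q (ball 0 R))
    (r : ℝ) (hr1 : r < 1) : ContinuousOn (fun t : ℝ => dslope q 0 t) (Set.Icc 0 r) := by
  have hn : ball (0:ℂ) R ∈ nhds (0:ℂ) := ball_mem_nhds _ (by linarith)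
  have h1 : ContinuousOn (dslope q 0) (ball 0 R) :=
    (continuousOn_dslope hn).2 ⟨hq.continuousOn, hq.differentiableAt hn⟩
  apply h1.comp continuous_ofReal.continuousOn
  intro t ht
  simp only [mem_ball_zero_iff, norm_real, Real.norm_eq_abs, abs_of_nonneg ht.1]
  linarith [ht.2]

lemma aux_combine (q m : ℂ → ℂ) (R : ℝ) (hR : 1 < R) (hq : DifferentiableOn ℂ q (ball 0 R))
    (hq0 : q 0 = 1) (hqre : ∀ z ∈ ball (0:ℂ) R, 0 < (q z).re)
    (hm : DifferentiableOn ℂ m (ball 0 R))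
    (hm0 : m 0 = 1) (hmre : ∀ z ∈ ball (0:ℂ) R, 0 < (m z).re)
    (r : ℝ) (hr0 : 0 ≤ r) (hr1 : r < 1) (β σ C : ℝ)
    (hC : ∀ η ζ : ℂ, ‖η‖ = 1 → ‖ζ‖ = 1 → C ≤
      σ * (β * (∫ t in (0:ℝ)..r, (2 * η / ((1 - η * t) * (1 - ζ * t))).re)
        + ∫ t in (0:ℝ)..r, (ζ / (1 - ζ * t)).re)) :
    C ≤ σ * ∫ t in (0:ℝ)..r,
      (β * dslope q 0 t + (1 + β * t * dslope q 0 t) / 2 * dslope m 0 t).re := by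
  have hP := aux_dsc q R hR hq r hr1
  have hM := aux_dsc m R hR hm r hr1
  have II : ∀ f : ℝ → ℂ, ContinuousOn f (Set.Icc 0 r) →
      IntervalIntegrable (fun t => (f t).re) MeasureTheory.volume 0 r := by
    intro f hf
    apply ContinuousOn.intervalIntegrable
    rw [Set.uIcc_of_le hr0]
    exact continuous_re.comp_continuousOn hf
  have ht : ContinuousOn (fun t : ℝ => (t : ℂ)) (Set.Icc 0 r) := continuous_ofReal.continuousOn
  have hφ1 : ContinuousOn (fun t : ℝ => (σ : ℂ) * ((1 + β * t * dslope q 0 t) / 2)) (Set.Icc 0 r) := by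
    fun_prop
  have hsplit : σ * ∫ t in (0:ℝ)..r,
      (β * dslope q 0 t + (1 + β * t * dslope q 0 t) / 2 * dslope m 0 t).re
      = (∫ t in (0:ℝ)..r, ((σ * β : ℂ) * dslope q 0 t).re)
        + ∫ t in (0:ℝ)..r, ((σ : ℂ) * ((1 + β * t * dslope q 0 t) / 2) * dslope m 0 t).re := by
    rw [← intervalIntegral.integral_add (II (fun t : ℝ => (σ * β : ℂ) * dslope q 0 t) (continuousOn_const.mul hP)) (II (fun t : ℝ => (σ : ℂ) * ((1 + β * t * dslope q 0 t) / 2) * dslope m 0 t) (hφ1.mul hM)),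
      ← intervalIntegral.integral_const_mul]
    apply intervalIntegral.integral_congr
    intro t _
    simp only []
    rw [← add_re, ← re_ofReal_mul]; congr 1; ring
  rw [hsplit, ← sub_le_iff_le_add']
  apply aux_A m R hR hm hm0 hmre r hr0 hr1 _ hφ1
  intro ζ hζ
  have hcζ := aux_cont ζ hζ r hr1
  rw [sub_le_iff_le_add']
  have hφ2 : ContinuousOn (fun t : ℝ => (σ * β : ℂ) * (1 - ζ * t)⁻¹) (Set.Icc 0 r) :=
    continuousOn_const.mul hcζ
  have hsplit2 : (∫ t in (0:ℝ)..r, ((σ * β : ℂ) * dslope q 0 t).re)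
        + ∫ t in (0:ℝ)..r, ((σ : ℂ) * ((1 + β * t * dslope q 0 t) / 2) * (2 * ζ / (1 - ζ * t))).re
      = (∫ t in (0:ℝ)..r, ((σ * β : ℂ) * (1 - ζ * t)⁻¹ * dslope q 0 t).re)
        + σ * ∫ t in (0:ℝ)..r, (ζ / (1 - ζ * t)).re := by
    have hz : ContinuousOn (fun t : ℝ => ζ / (1 - ζ * t)) (Set.Icc 0 r) := by
      simp only [div_eq_mul_inv]; exact continuousOn_const.mul hcζ
    have hz2 : ContinuousOn (fun t : ℝ => 2 * ζ / (1 - ζ * t)) (Set.Icc 0 r) := by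
      simp only [div_eq_mul_inv]; exact continuousOn_const.mul hcζ
    rw [← intervalIntegral.integral_const_mul,
      ← intervalIntegral.integral_add (II (fun t : ℝ => (σ * β : ℂ) * dslope q 0 t) (continuousOn_const.mul hP)) (II (fun t : ℝ => (σ : ℂ) * ((1 + β * t * dslope q 0 t) / 2) * (2 * ζ / (1 - ζ * t))) (hφ1.mul hz2)),
      ← intervalIntegral.integral_add (II (fun t : ℝ => (σ * β : ℂ) * (1 - ζ * t)⁻¹ * dslope q 0 t) (hφ2.mul hP)) ((II _ hz).const_mul σ)]
    apply intervalIntegral.integral_congr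
    intro t htt
    rw [Set.uIcc_of_le hr0] at htt
    have := aux_ne' ζ hζ r t hr1 htt
    simp only []
    rw [← add_re, ← re_ofReal_mul, ← add_re]; congr 1
    have hN := mul_inv_cancel₀ this
    simp only [div_eq_mul_inv]
    generalize (1 - ζ * (t:ℂ))⁻¹ = N at *
    linear_combination (-(σ * β * dslope q 0 t : ℂ)) * hN
  rw [hsplit2, ← sub_le_iff_le_add]
  apply aux_A q R hR hq hq0 hqre r hr0 hr1 _ hφ2
  intro η hη
  have h1 := hC η ζ hη hζ
  rw [mul_add, ← mul_assoc, ← intervalIntegral.integral_const_mul] at h1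
  rw [sub_le_iff_le_add]
  refine h1.trans (le_of_eq ?_)
  congr 1
  apply intervalIntegral.integral_congr
  intro t htt
  rw [Set.uIcc_of_le hr0] at htt
  have := aux_ne' ζ hζ r t hr1 htt
  have := aux_ne' η hη r t hr1 htt
  simp only []
  rw [← re_ofReal_mul]; congr 1; push_cast
  field_simp

lemma aux_lognorm (f f' : ℝ → ℂ) (r : ℝ) (hr0 : 0 ≤ r)
    (hd : ∀ t ∈ Set.Icc 0 r, HasDerivAt f (f' t) t) (hc : ContinuousOn f' (Set.Icc 0 r))
    (hne : ∀ t ∈ Set.Icc 0 r, f t ≠ 0) :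
    ∫ t in (0:ℝ)..r, (f' t / f t).re = Real.log ‖f r‖ - Real.log ‖f 0‖ := by
  have hfc : ContinuousOn f (Set.Icc 0 r) := fun t ht => (hd t ht).continuousAt.continuousWithinAt
  have hd2 : ∀ t ∈ Set.uIcc 0 r, HasDerivAt (fun t => Real.log ‖f t‖) (f' t / f t).re t := by
    intro t ht
    rw [Set.uIcc_of_le hr0] at ht
    have h0 := hne t ht
    have hn : ‖f t‖ ^ 2 ≠ 0 := by simpa using h0
    have h1 := ((hd t ht).norm_sq.log hn).const_mul (1/2 : ℝ)
    have h2 : (fun t => Real.log ‖f t‖) = fun t => (1/2 : ℝ) * Real.log (‖f t‖ ^ 2) := by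
      funext t; rw [Real.log_pow]; push_cast; ring
    rw [h2]
    refine h1.congr_deriv ?_
    rw [div_re, ← normSq_eq_norm_sq, Complex.inner]
    simp only [mul_re, conj_re, conj_im]
    ring
  apply intervalIntegral.integral_eq_sub_of_hasDerivAt hd2
  apply ContinuousOn.intervalIntegrable
  rw [Set.uIcc_of_le hr0]
  exact continuous_re.comp_continuousOn (hc.div hfc hne)

lemma aux_upk (η ζ : ℂ) (hη : ‖η‖ = 1) (hζ : ‖ζ‖ = 1) (r : ℝ) (hr0 : 0 ≤ r) (hr : r < 1) :
    (∫ t in (0:ℝ)..r, (2 * η / ((1 - η * t) * (1 - ζ * t))).re) ≤ 2 * r / (1 - r) := by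
  have hcont : ContinuousOn (fun t : ℝ => 2 * η / ((1 - η * t) * (1 - ζ * t))) (Set.Icc 0 r) := by
    simp only [div_eq_mul_inv, mul_inv]
    exact continuousOn_const.mul ((aux_cont η hη r hr).mul (aux_cont ζ hζ r hr))
  have hpos : ∀ t ∈ Set.Icc 0 r, 0 < 1 - t := fun t ht => by linarith [ht.2]
  have hc2 : ContinuousOn (fun t : ℝ => 2 / (1 - t) ^ 2) (Set.Icc 0 r) := by
    apply ContinuousOn.div (by fun_prop) (by fun_prop)
    intro t ht; exact pow_ne_zero _ (hpos t ht).ne'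
  have hi2 : IntervalIntegrable (fun t : ℝ => 2 / (1 - t) ^ 2) MeasureTheory.volume 0 r := by
    apply ContinuousOn.intervalIntegrable; rwa [Set.uIcc_of_le hr0]
  have h2 : ∫ t in (0:ℝ)..r, 2 / (1 - t) ^ 2 = 2 * r / (1 - r) := by
    rw [intervalIntegral.integral_eq_sub_of_hasDerivAt (f := fun t => 2 * t / (1 - t)) _ hi2]
    · simp
    · intro t ht
      rw [Set.uIcc_of_le hr0] at ht
      have h0 := (hpos t ht).ne'
      have := ((hasDerivAt_id t).const_mul 2).div ((hasDerivAt_id t).const_sub 1) h0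
      refine this.congr_deriv ?_
      simp only [id]
      field_simp
      ring
  rw [← h2]
  apply intervalIntegral.integral_mono_on hr0 _ hi2
  · intro t ht
    refine (re_le_norm _).trans ?_
    have hp := hpos t ht
    have hb : ∀ η : ℂ, ‖η‖ = 1 → 1 - t ≤ ‖1 - η * t‖ := by
      intro η hη
      have := norm_sub_norm_le (1:ℂ) (η * t)
      rwa [norm_mul, hη, norm_real, Real.norm_eq_abs, abs_of_nonneg ht.1, norm_one, one_mul] at this
    rw [norm_div, norm_mul, norm_mul, hη, sq]
    have : ‖(2:ℂ)‖ * 1 = 2 := by simp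
    rw [this]
    have h1 := hb η hη
    have h3 := hb ζ hζ
    gcongr
  · apply ContinuousOn.intervalIntegrable
    rw [Set.uIcc_of_le hr0]
    exact continuous_re.comp_continuousOn hcont

lemma aux_main (α : ℝ) (hα0 : 0 ≤ α) (hα1 : α < 1)
    (h g : ℂ → ℂ)
    (hh : DifferentiableOn ℂ h (ball 0 1))
    (hg : DifferentiableOn ℂ g (ball 0 1))
    (hh0 : h 0 = 1)
    (hhne : ∀ z ∈ ball (0:ℂ) 1, h z ≠ 0)
    (hgne : ∀ z ∈ ball (0:ℂ) 1, g z ≠ 0)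
    (hsp : ∀ z ∈ ball (0:ℂ) 1,
      ‖z * deriv g z / g z‖ < ‖1 + z * deriv h z / h z‖)
    (hstar : ∀ z ∈ ball (0:ℂ) 1, z ≠ 0 →
      α < (1 + z * deriv h z / h z - (starRingEnd ℂ) (z * deriv g z / g z)).re)
    (c : ℂ) (hc0 : c ≠ 0) (hc1 : ‖c‖ < 1) (r : ℝ) (hr0 : 0 ≤ r) (hr1 : r < 1) :
    -Real.log (1 + r) - (1 - α) * (2 * r / (1 + r)) ≤ Real.log ‖h (c * r)‖ ∧
    Real.log ‖h (c * r)‖ ≤ -Real.log (1 - r) + (1 - α) * (2 * r / (1 - r)) := by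
  have hcpos : 0 < ‖c‖ := norm_pos_iff.2 hc0
  set R := ‖c‖⁻¹ with hRdef
  have hR : 1 < R := (one_lt_inv₀ hcpos).2 hc1
  have hmaps : ∀ z ∈ ball (0:ℂ) R, c * z ∈ ball (0:ℂ) 1 := by
    intro z hz
    rw [mem_ball_zero_iff] at *
    rw [norm_mul]
    calc ‖c‖ * ‖z‖ < ‖c‖ * R := by gcongr
      _ = 1 := mul_inv_cancel₀ hcpos.ne'
  set H : ℂ → ℂ := fun z => 1 + z * deriv h z / h z with hH
  set G : ℂ → ℂ := fun z => z * deriv g z / g z with hG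
  have hHd : DifferentiableOn ℂ H (ball 0 1) :=
    (differentiableOn_const _).add ((differentiableOn_id.mul (hh.deriv isOpen_ball)).div hh hhne)
  have hGd : DifferentiableOn ℂ G (ball 0 1) :=
    (differentiableOn_id.mul (hg.deriv isOpen_ball)).div hg hgne
  have hp : ∀ z ∈ ball (0:ℂ) 1, α < (H z - G z).re := by
    intro z hz
    by_cases h0 : z = 0
    · simp [hH, hG, h0, hα1]
    · have := hstar z hz h0
      rw [sub_re, conj_re] at this
      rwa [sub_re]
  have hpne : ∀ z ∈ ball (0:ℂ) 1, H z - G z ≠ 0 := by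
    intro z hz h0
    have := hp z hz
    rw [h0] at this; simp at this; linarith
  have hcd : DifferentiableOn ℂ (fun z => c * z) (ball 0 R) := by fun_prop
  have hβ : 0 < 1 - α := by linarith
  have hβ' : ((1 - α : ℝ) : ℂ) ≠ 0 := by exact_mod_cast hβ.ne'
  set q : ℂ → ℂ := fun z => (H (c * z) - G (c * z) - α) / ((1 - α : ℝ) : ℂ) with hq
  set m : ℂ → ℂ := fun z => (H (c * z) + G (c * z)) / (H (c * z) - G (c * z)) with hm
  have hHc := hHd.comp hcd hmaps
  have hGc := hGd.comp hcd hmaps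
  have hqd : DifferentiableOn ℂ q (ball 0 R) := ((hHc.sub hGc).sub_const _).div_const _
  have hmd : DifferentiableOn ℂ m (ball 0 R) :=
    (hHc.add hGc).div (hHc.sub hGc) (fun z hz => hpne _ (hmaps z hz))
  have hq0 : q 0 = 1 := by
    simp only [hq, hH, hG]; push_cast at hβ' ⊢; simp; exact hβ'
  have hm0 : m 0 = 1 := by simp [hm, hH, hG]
  have hqre : ∀ z ∈ ball (0:ℂ) R, 0 < (q z).re := by
    intro z hz
    have := hp _ (hmaps z hz)
    simp only [hq]
    rw [div_ofReal_re, sub_re, ofReal_re]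
    exact div_pos (by linarith) hβ
  have hmre : ∀ z ∈ ball (0:ℂ) R, 0 < (m z).re := by
    intro z hz
    have h1 : ‖G (c * z)‖ < ‖H (c * z)‖ := hsp _ (hmaps z hz)
    have h2 := hpne _ (hmaps z hz)
    simp only [hm]
    generalize H (c * z) = X at *
    generalize G (c * z) = Y at *
    have h3 : 0 < normSq (X - Y) := normSq_pos.2 h2
    have h4 : normSq Y < normSq X := by
      rw [normSq_eq_norm_sq, normSq_eq_norm_sq]; gcongr
    rw [normSq_apply, normSq_apply] at h4
    rw [div_re, ← add_div]
    apply div_pos _ h3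
    simp only [add_re, sub_re, add_im, sub_im]
    nlinarith
  have hball : ∀ t ∈ Set.Icc 0 r, (t:ℂ) ∈ ball (0:ℂ) R := by
    intro t ht
    rw [mem_ball_zero_iff, norm_real, Real.norm_eq_abs, abs_of_nonneg ht.1]; linarith [ht.2]
  have hlog : Real.log ‖h (c * r)‖ = ∫ t in (0:ℝ)..r,
      (((1 - α : ℝ) : ℂ) * dslope q 0 t + (1 + ((1 - α : ℝ) : ℂ) * t * dslope q 0 t) / 2 * dslope m 0 t).re := by
    have hd : ∀ t ∈ Set.Icc 0 r, HasDerivAt (fun t : ℝ => h (c * t)) (deriv h (c * t) * c) t := by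
      intro t ht
      have h1 := (hh.differentiableAt (isOpen_ball.mem_nhds (hmaps _ (hball t ht)))).hasDerivAt
      have h2 : HasDerivAt (fun t : ℝ => c * (t:ℂ)) c t := by
        simpa using ((hasDerivAt_id t).ofReal_comp.const_mul c)
      exact h1.comp t h2
    have hcont : ContinuousOn (fun t : ℝ => deriv h (c * t) * c) (Set.Icc 0 r) := by
      apply ContinuousOn.mul _ continuousOn_const
      apply (hh.deriv isOpen_ball).continuousOn.comp (by fun_prop)
      intro t ht; exact hmaps _ (hball t ht)
    have h1 := aux_lognorm (fun t : ℝ => h (c * t)) _ r hr0 hd hcont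
      (fun t ht => hhne _ (hmaps _ (hball t ht)))
    simp only [ofReal_zero, mul_zero, hh0, norm_one, Real.log_one, sub_zero] at h1
    rw [← h1]
    apply intervalIntegral.integral_congr_ae
    refine Filter.Eventually.of_forall fun t ht => ?_
    rw [Set.uIoc_of_le hr0] at ht
    have htt : t ∈ Set.Icc 0 r := Set.Ioc_subset_Icc_self ht
    have ht0 : (t:ℂ) ≠ 0 := by exact_mod_cast ht.1.ne'
    congr 1
    have e1 := sub_smul_dslope q 0 t
    have e2 := sub_smul_dslope m 0 t
    rw [hq0, sub_zero, smul_eq_mul] at e1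
    rw [hm0, sub_zero, smul_eq_mul] at e2
    have hz := hmaps _ (hball t htt)
    have e3 := hpne _ hz
    have e4 := hhne _ hz
    have e5 : c * t * deriv h (c * t) / h (c * t) = H (c * t) - 1 := by simp [hH]
    have e6 : ((1 - α : ℝ) : ℂ) * (q t - 1) = H (c * t) - G (c * t) - 1 := by
      simp only [hq]; field_simp; push_cast; ring
    have e7 : m t * (H (c * t) - G (c * t)) = (H (c * t) + G (c * t)) := by
      simp only [hm]; field_simp
    apply mul_left_cancel₀ ht0
    have e8 : (t:ℂ) * (deriv h (c * t) * c / h (c * t)) = H (c * t) - 1 := by rw [← e5]; ring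
    rw [e8]
    generalize dslope q 0 t = P at *
    generalize dslope m 0 t = M at *
    generalize H (c * t) = X at *
    generalize G (c * t) = Y at *
    generalize ((1 - α : ℝ) : ℂ) = B at *
    have e9 : B * (t * P) = X - Y - 1 := by rw [e1, e6]
    have e10 : (1 + t * M) * (X - Y) = X + Y := by rw [e2, ← e7]; ring
    linear_combination -(1 + t * M / 2) * e9 - e10 / 2
  constructor
  · have := aux_combine q m R hR hqd hq0 hqre hmd hm0 hmre r hr0 hr1 (1 - α) 1
      (-Real.log (1 + r) - (1 - α) * (2 * r / (1 + r))) ?_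
    · rwa [one_mul, ← hlog] at this
    · intro η ζ hη hζ
      have h1 := aux_kernel η ζ hη hζ r hr0 hr1
      rw [aux_int1 ζ hζ r hr0 hr1]
      have h2 : (Complex.log (1 - ζ * r)).re ≤ Real.log (1 + r) := by
        rw [log_re]
        apply Real.log_le_log (norm_pos_iff.2 (aux_ne' ζ hζ r r hr1 ⟨hr0, le_rfl⟩))
        refine (norm_sub_le _ _).trans ?_
        rw [norm_mul, hζ, norm_real, Real.norm_eq_abs, abs_of_nonneg hr0]; simp
      have h3 := mul_le_mul_of_nonneg_left h1 hβ.le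
      have h4 := mul_le_mul_of_nonneg_left h2 hα0
      linarith
  · have := aux_combine q m R hR hqd hq0 hqre hmd hm0 hmre r hr0 hr1 (1 - α) (-1)
      (-(-Real.log (1 - r) + (1 - α) * (2 * r / (1 - r)))) ?_
    · rw [← hlog] at this; linarith
    · intro η ζ hη hζ
      have h1 := aux_upk η ζ hη hζ r hr0 hr1
      rw [aux_int1 ζ hζ r hr0 hr1]
      have h2 : Real.log (1 - r) ≤ (Complex.log (1 - ζ * r)).re := by
        rw [log_re]
        apply Real.log_le_log (by linarith)
        have := norm_sub_norm_le (1:ℂ) (ζ * r)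
        rwa [norm_mul, hζ, norm_real, Real.norm_eq_abs, abs_of_nonneg hr0, norm_one, one_mul] at this
      have h3 := mul_le_mul_of_nonneg_left h1 hβ.le
      linarith

/-- Distortion theorem for the analytic factor `h` of a log-harmonic starlike
mapping `f(z) = z h(z) conj(g z)` of order `α`. -/
theorem stmt_0 (α : ℝ) (hα0 : 0 ≤ α) (hα1 : α < 1)
    (h g : ℂ → ℂ)
    (hh : DifferentiableOn ℂ h (ball 0 1))
    (hg : DifferentiableOn ℂ g (ball 0 1))
    (hh0 : h 0 = 1) (hg0 : g 0 = 1)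
    (hhne : ∀ z ∈ ball (0:ℂ) 1, h z ≠ 0)
    (hgne : ∀ z ∈ ball (0:ℂ) 1, g z ≠ 0)
    (hsp : ∀ z ∈ ball (0:ℂ) 1,
      ‖z * deriv g z / g z‖ < ‖1 + z * deriv h z / h z‖)
    (hinj : Set.InjOn (fun z => z * h z * (starRingEnd ℂ) (g z)) (ball 0 1))
    (hstar : ∀ z ∈ ball (0:ℂ) 1, z ≠ 0 →
      α < (1 + z * deriv h z / h z - (starRingEnd ℂ) (z * deriv g z / g z)).re) :
    ∀ z ∈ ball (0:ℂ) 1,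
      (1 / (1 + ‖z‖)) * Real.exp (-2 * (1 - α) * ‖z‖ / (1 + ‖z‖)) ≤ ‖h z‖ ∧
      ‖h z‖ ≤ (1 / (1 - ‖z‖)) * Real.exp (2 * (1 - α) * ‖z‖ / (1 - ‖z‖)) := by
  intro z hz
  by_cases hz0 : z = 0
  · subst hz0; simp [hh0]
  have hz1 : ‖z‖ < 1 := by simpa using hz
  have hzp : 0 < ‖z‖ := norm_pos_iff.2 hz0
  have hzp' : (‖z‖ : ℂ) ≠ 0 := by exact_mod_cast hzp.ne'
  have hs : ∀ s ∈ Set.Ioo ‖z‖ 1,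
      -Real.log (1 + ‖z‖ / s) - (1 - α) * (2 * (‖z‖ / s) / (1 + ‖z‖ / s)) ≤ Real.log ‖h z‖ ∧
      Real.log ‖h z‖ ≤ -Real.log (1 - ‖z‖ / s) + (1 - α) * (2 * (‖z‖ / s) / (1 - ‖z‖ / s)) := by
    intro s hs
    have hs0 : 0 < s := hzp.trans hs.1
    have hs0' : (s : ℂ) ≠ 0 := by exact_mod_cast hs0.ne'
    have := aux_main α hα0 hα1 h g hh hg hh0 hhne hgne hsp hstar (s * z / ‖z‖)
      (by simp [hs0.ne', hz0]) (by
        rw [norm_div, norm_mul, norm_real, norm_real, norm_norm, mul_div_assoc, div_self hzp.ne',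
          mul_one, Real.norm_eq_abs, abs_of_pos hs0]; exact hs.2)
      (‖z‖ / s) (by positivity) ((div_lt_one hs0).2 hs.1)
    have e : (s * z / ‖z‖ : ℂ) * ((‖z‖ / s : ℝ) : ℂ) = z := by push_cast; field_simp
    rwa [e] at this
  have hev : ∀ᶠ s in nhdsWithin (1:ℝ) (Set.Iio 1), s ∈ Set.Ioo ‖z‖ 1 := Ioo_mem_nhdsLT hz1
  have hdv : ContinuousAt (fun s : ℝ => ‖z‖ / s) 1 := by
    apply ContinuousAt.div continuousAt_const continuousAt_id one_ne_zero
  have hpa : (1:ℝ) + ‖z‖ / 1 ≠ 0 := by rw [div_one]; positivity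
  have hpb : (1:ℝ) - ‖z‖ / 1 ≠ 0 := by rw [div_one]; linarith
  have hlo : ContinuousAt (fun s : ℝ =>
      -Real.log (1 + ‖z‖ / s) - (1 - α) * (2 * (‖z‖ / s) / (1 + ‖z‖ / s))) 1 := by
    have h1 := continuousAt_const (y := (1:ℝ)).add hdv
    exact (h1.log hpa).neg.sub (continuousAt_const.mul ((continuousAt_const.mul hdv).div h1 hpa))
  have hup : ContinuousAt (fun s : ℝ =>
      -Real.log (1 - ‖z‖ / s) + (1 - α) * (2 * (‖z‖ / s) / (1 - ‖z‖ / s))) 1 := by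
    have h1 := continuousAt_const (y := (1:ℝ)).sub hdv
    exact (h1.log hpb).neg.add (continuousAt_const.mul ((continuousAt_const.mul hdv).div h1 hpb))
  have L1 := le_of_tendsto (hlo.tendsto.mono_left nhdsWithin_le_nhds)
    (hev.mono fun s h => (hs s h).1)
  have L2 := ge_of_tendsto (hup.tendsto.mono_left nhdsWithin_le_nhds)
    (hev.mono fun s h => (hs s h).2)
  simp only [div_one] at L1 L2
  have hhp : 0 < ‖h z‖ := norm_pos_iff.2 (hhne z hz)
  have hA : 0 < 1 + ‖z‖ := by positivity
  have hB : 0 < 1 - ‖z‖ := by linarith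
  constructor
  · rw [← Real.exp_log hhp]
    have : 1 / (1 + ‖z‖) = Real.exp (-Real.log (1 + ‖z‖)) := by
      rw [Real.exp_neg, Real.exp_log hA, one_div]
    rw [this, ← Real.exp_add]
    apply Real.exp_le_exp.2
    refine le_trans (le_of_eq ?_) L1
    ring
  · rw [← Real.exp_log hhp]
    have : 1 / (1 - ‖z‖) = Real.exp (-Real.log (1 - ‖z‖)) := by
      rw [Real.exp_neg, Real.exp_log hB, one_div]
    rw [this, ← Real.exp_add]
    apply Real.exp_le_exp.2
    refine L2.trans (le_of_eq ?_)
    ring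
end

section
/- Let 0 ≤ α < 1 and let f(z) = z·h(z)·conj(g(z)) belong to S*_Lh(α), with h(z) = exp(Σ_{n≥1} aₙ zⁿ). Then |aₙ| ≤ 2(1−α) + 1/n for every integer n ≥ 1. -/
open Complex Metric

lemma aux_unique (F : ℂ → ℂ) (c : ℕ → ℂ)
    (hc : ∀ z ∈ ball (0:ℂ) 1, HasSum (fun n => c n * z ^ n) (F z))
    (p : FormalMultilinearSeries ℂ ℂ ℂ) (hp : HasFPowerSeriesAt F p 0) (n : ℕ) :
    c n = p.coeff n := by
  have h1 : HasFPowerSeriesAt F (FormalMultilinearSeries.ofScalars ℂ c) 0 := by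
    rw [hasFPowerSeriesAt_iff]
    filter_upwards [ball_mem_nhds (0:ℂ) one_pos] with z hz
    simpa [mul_comm] using hc z hz
  have := h1.eq_formalMultilinearSeries hp
  rw [← this]; simp

lemma aux_unique2 (F : ℂ → ℂ) (c d : ℕ → ℂ)
    (hc : ∀ z ∈ ball (0:ℂ) 1, HasSum (fun n => c n * z ^ n) (F z))
    (hd : ∀ z ∈ ball (0:ℂ) 1, HasSum (fun n => d n * z ^ n) (F z)) (n : ℕ) :
    c n = d n := by
  have h1 : HasFPowerSeriesAt F (FormalMultilinearSeries.ofScalars ℂ d) 0 := by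
    rw [hasFPowerSeriesAt_iff]
    filter_upwards [ball_mem_nhds (0:ℂ) one_pos] with z hz
    simpa [mul_comm] using hd z hz
  simpa using aux_unique F c hc _ h1 n

lemma aux_taylor (F : ℂ → ℂ) (hF : DifferentiableOn ℂ F (ball 0 1)) :
    ∀ z ∈ ball (0:ℂ) 1,
      HasSum (fun n => ((n.factorial : ℂ)⁻¹ * iteratedDeriv n F 0) * z ^ n) (F z) := by
  intro z hz
  have := Complex.hasSum_taylorSeries_on_ball (r := 1) (f := F) (c := 0) (by simpa using hF) (z := z) (by simpa using hz)
  convert! this using 2 with n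
  simp; ring

lemma aux_phase (c : ℂ) : ∃ v : ℂ, ‖v‖ = 1 ∧ v * c = ‖c‖ := by
  by_cases h : c = 0
  · exact ⟨1, by simp, by simp [h]⟩
  · have h' : (‖c‖ : ℂ) ≠ 0 := by simpa using h
    refine ⟨(starRingEnd ℂ) c / ‖c‖, by simp [h], ?_⟩
    rw [div_mul_eq_mul_div, div_eq_iff h', Complex.conj_mul']; ring

lemma aux_carath_r (F : ℂ → ℂ) (hF : DifferentiableOn ℂ F (ball 0 1))
    (hre : ∀ z ∈ ball (0:ℂ) 1, 0 ≤ (F z).re) (c : ℕ → ℂ)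
    (hc : ∀ z ∈ ball (0:ℂ) 1, HasSum (fun n => c n * z ^ n) (F z))
    (n : ℕ) (hn : n ≠ 0) (r : ℝ) (hr : 0 < r) (hr1 : r < 1) :
    ‖c n‖ * r ^ n ≤ 2 * (F 0).re := by
  obtain ⟨v, hv, hvc⟩ := aux_phase (c n)
  have hsub : closedBall (0:ℂ) r ⊆ ball 0 1 := closedBall_subset_ball hr1
  have hd : DiffContOnCl ℂ F (ball 0 r) :=
    (hF.mono hsub).diffContOnCl_ball subset_rfl
  have hFc : ContinuousOn F (sphere 0 |r|) := by
    rw [abs_of_pos hr]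
    exact (hF.continuousOn).mono (sphere_subset_closedBall.trans hsub)
  have hrc : (r:ℂ) ≠ 0 := by exact_mod_cast hr.ne'
  have hz0 : ∀ z ∈ sphere (0:ℂ) |r|, z ≠ 0 := by
    intro z hz h0
    rw [abs_of_pos hr] at hz
    simp [h0] at hz; exact hr.ne hz
  -- average formulas
  have e1 : Real.circleAverage F 0 r = F 0 :=
    DiffContOnCl.circleAverage (by rwa [abs_of_pos hr])
  have e2 : Real.circleAverage (fun z => (z / r) ^ n * F z) 0 r = 0 := by
    have : DiffContOnCl ℂ (fun z => (z / r) ^ n * F z) (ball 0 |r|) := by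
      rw [abs_of_pos hr]
      have h1 : Differentiable ℂ (fun z : ℂ => (z / r) ^ n) := by fun_prop
      exact h1.diffContOnCl.smul hd
    rw [this.circleAverage]; simp [hn]
  have e3 : Real.circleAverage (fun z => (r / z) ^ n * F z) 0 r = c n * r ^ n := by
    lift r to NNReal using hr.le
    have hps := hd.hasFPowerSeriesOnBall (by exact_mod_cast hr)
    have := aux_unique F c hc _ hps.hasFPowerSeriesAt n
    have h2 := cauchyPowerSeries_apply F 0 r n (r : ℂ)
    rw [Real.circleAverage_eq_circleIntegral hr.ne']
    rw [this]
    rw [FormalMultilinearSeries.apply_eq_pow_smul_coeff] at h2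
    rw [mul_comm (FormalMultilinearSeries.coeff _ _), ← smul_eq_mul ((r:ℂ) ^ n), h2]
    congr 2; ext z; simp; ring
  have i1 : CircleIntegrable F 0 r := hFc.circleIntegrable'
  have i2 : CircleIntegrable (fun z => (z / r) ^ n * F z) 0 r :=
    ContinuousOn.circleIntegrable' (by fun_prop)
  have i3 : CircleIntegrable (fun z => (r / z) ^ n * F z) 0 r :=
    ContinuousOn.circleIntegrable' (((continuousOn_const.div continuousOn_id hz0).pow n).mul hFc)
  let G : ℂ → ℂ := fun z => ((2:ℂ) • F z - (starRingEnd ℂ v) • ((z / r) ^ n * F z)) - v • ((r / z) ^ n * F z)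
  have j1 : CircleIntegrable (fun z => (2:ℂ) • F z) 0 r := i1.const_fun_smul
  have j2 : CircleIntegrable (fun z => (starRingEnd ℂ v) • ((z / r) ^ n * F z)) 0 r := i2.const_fun_smul
  have j3 : CircleIntegrable (fun z => v • ((r / z) ^ n * F z)) 0 r := i3.const_fun_smul
  have j12 : CircleIntegrable (fun z => (2:ℂ) • F z - (starRingEnd ℂ v) • ((z / r) ^ n * F z)) 0 r := j1.sub j2
  have hGi : CircleIntegrable G 0 r := j12.sub j3
  have hG : Real.circleAverage G 0 r = 2 * F 0 - v * (c n * r ^ n) := by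
    change Real.circleAverage (fun z => ((2:ℂ) • F z - (starRingEnd ℂ v) • ((z / r) ^ n * F z)) - v • ((r / z) ^ n * F z)) 0 r = _
    rw [Real.circleAverage_fun_sub j12 j3, Real.circleAverage_fun_sub j1 j2,
      Real.circleAverage_fun_smul, Real.circleAverage_fun_smul, Real.circleAverage_fun_smul,
      e1, e2, e3]
    simp
  have hpos : 0 ≤ Real.circleAverage (Complex.reCLM ∘ G) 0 r := by
    apply Real.circleAverage_nonneg_of_nonneg
    intro z hz
    have hzr : ‖z‖ = r := by simpa [abs_of_pos hr] using hz
    have hzb : z ∈ ball (0:ℂ) 1 := by simpa [hzr] using hr1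
    have h1 : (r / z : ℂ) = starRingEnd ℂ (z / r) := by
      rw [map_div₀, Complex.conj_ofReal, div_eq_div_iff (hz0 z hz) hrc, Complex.conj_mul', hzr]
      ring
    have h2 : G z = ((2 * (1 - (v * (r / z) ^ n).re) : ℝ) : ℂ) * F z := by
      have h3 : (starRingEnd ℂ v) * (z / r) ^ n = starRingEnd ℂ (v * (r / z) ^ n) := by
        rw [h1]; simp
      have h4 := Complex.add_conj (v * (r / z) ^ n)
      rw [← h3] at h4
      push_cast at h4 ⊢
      simp only [G, smul_eq_mul]
      linear_combination (-F z) * h4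
    have h5 : (v * (r / z) ^ n).re ≤ 1 := by
      refine (Complex.re_le_norm _).trans ?_
      simp [hv, hzr, abs_of_pos hr, hr.ne']
    simp only [Function.comp, Complex.reCLM_apply, h2, Complex.re_ofReal_mul]
    exact mul_nonneg (by linarith) (hre z hzb)
  rw [ContinuousLinearMap.circleAverage_comp_comm _ hGi, hG, ← mul_assoc, hvc] at hpos
  have : ((‖c n‖ : ℂ) * (r:ℂ) ^ n) = ((‖c n‖ * r ^ n : ℝ) : ℂ) := by push_cast; ring
  rw [this] at hpos
  simp only [Complex.reCLM_apply, Complex.sub_re, Complex.ofReal_re] at hpos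
  simp at hpos
  exact hpos

lemma aux_carath (F : ℂ → ℂ) (hF : DifferentiableOn ℂ F (ball 0 1)) (β : ℝ)
    (hre : ∀ z ∈ ball (0:ℂ) 1, β ≤ (F z).re) (h0 : F 0 = 1) (c : ℕ → ℂ)
    (hc : ∀ z ∈ ball (0:ℂ) 1, HasSum (fun n => c n * z ^ n) (F z))
    (n : ℕ) (hn : n ≠ 0) :
    ‖c n‖ ≤ 2 * (1 - β) := by
  have key : ∀ r : ℝ, 0 < r → r < 1 → ‖c n‖ * r ^ n ≤ 2 * (1 - β) := by
    intro r hr hr1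
    have := aux_carath_r (fun z => F z - β) (hF.sub_const _)
      (fun z hz => by simpa using hre z hz)
      (fun k => c k - if k = 0 then (β:ℂ) else 0) ?_ n hn r hr hr1
    · simpa [hn, h0] using this
    · intro z hz
      have h2 : HasSum (fun k : ℕ => (if k = 0 then (β:ℂ) else 0) * z ^ k) β := by
        convert! hasSum_ite_eq (0:ℕ) (β:ℂ) using 2 with k
        by_cases hk : k = 0 <;> simp [hk]
      simpa [sub_mul] using (hc z hz).sub h2
  have ht : Filter.Tendsto (fun r : ℝ => ‖c n‖ * r ^ n) (nhdsWithin 1 (Set.Iio 1)) (nhds (‖c n‖ * 1 ^ n)) := by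
    apply Filter.Tendsto.mono_left _ nhdsWithin_le_nhds
    exact Continuous.tendsto (by fun_prop) _
  have := le_of_tendsto ht (b := 2 * (1 - β)) (by
    filter_upwards [Ioo_mem_nhdsLT (show (0:ℝ) < 1 by norm_num)] with r hr
    exact key r hr.1 hr.2)
  simpa using this

/-- Coefficient estimate for the analytic factor: if
`f(z) = z h(z) conj(g z) ∈ S*_Lh(α)` with `h(z) = exp(Σ_{n≥1} aₙ zⁿ)`,
then `|aₙ| ≤ 2(1-α) + 1/n` for all `n ≥ 1`. -/
theorem stmt_5 (α : ℝ) (hα0 : 0 ≤ α) (hα1 : α < 1)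
    (h g : ℂ → ℂ)
    (hh : DifferentiableOn ℂ h (ball 0 1))
    (hg : DifferentiableOn ℂ g (ball 0 1))
    (hh0 : h 0 = 1) (hg0 : g 0 = 1)
    (hhne : ∀ z ∈ ball (0:ℂ) 1, h z ≠ 0)
    (hgne : ∀ z ∈ ball (0:ℂ) 1, g z ≠ 0)
    (hsp : ∀ z ∈ ball (0:ℂ) 1,
      ‖z * deriv g z / g z‖ < ‖1 + z * deriv h z / h z‖)
    (hinj : Set.InjOn (fun z => z * h z * (starRingEnd ℂ) (g z)) (ball 0 1))
    (hstar : ∀ z ∈ ball (0:ℂ) 1, z ≠ 0 →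
      α < (1 + z * deriv h z / h z - (starRingEnd ℂ) (z * deriv g z / g z)).re)
    (a : ℕ → ℂ) (ha0 : a 0 = 0)
    (hha : ∀ z ∈ ball (0:ℂ) 1, ∃ w : ℂ,
      HasSum (fun n => a n * z ^ n) w ∧ h z = Complex.exp w) :
    ∀ n : ℕ, 1 ≤ n → ‖a n‖ ≤ 2 * (1 - α) + 1 / n := by
  intro n hn
  have hn0 : n ≠ 0 := by omega
  have hdh : DifferentiableOn ℂ (deriv h) (ball 0 1) := hh.deriv isOpen_ball
  have hdg : DifferentiableOn ℂ (deriv g) (ball 0 1) := hg.deriv isOpen_ball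
  set H : ℂ → ℂ := fun z => 1 + z * deriv h z / h z with hH
  set P : ℂ → ℂ := fun z => H z - z * deriv g z / g z with hP
  have dH : DifferentiableOn ℂ H (ball 0 1) :=
    (differentiableOn_const _).add ((differentiableOn_id.mul hdh).div hh hhne)
  have dP : DifferentiableOn ℂ P (ball 0 1) :=
    dH.sub ((differentiableOn_id.mul hdg).div hg hgne)
  have P0 : P 0 = 1 := by simp [hP, hH]
  have H0 : H 0 = 1 := by simp [hH]
  have Pre : ∀ z ∈ ball (0:ℂ) 1, α < (P z).re := by
    intro z hz
    by_cases h0 : z = 0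
    · rw [h0, P0]; simpa using hα1
    · have := hstar z hz h0
      rw [Complex.sub_re, Complex.conj_re] at this
      simpa [hP, hH] using this
  have Pne : ∀ z ∈ ball (0:ℂ) 1, P z ≠ 0 := by
    intro z hz h0
    have := Pre z hz
    rw [h0] at this; simp at this; linarith
  set Q : ℂ → ℂ := fun z => H z / P z with hQ
  have dQ : DifferentiableOn ℂ Q (ball 0 1) := dH.div dP Pne
  have Q0 : Q 0 = 1 := by simp [hQ, P0, H0]
  have Qre : ∀ z ∈ ball (0:ℂ) 1, (1/2 : ℝ) ≤ (Q z).re := by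
    intro z hz
    have h1 : ‖Q z - 1‖ < ‖Q z‖ := by
      have e : Q z - 1 = (z * deriv g z / g z) / P z := by
        rw [hQ]; dsimp only
        rw [div_sub_one (Pne z hz)]; congr 1; simp [hP]
      rw [e, hQ]; dsimp only
      rw [norm_div _ (P z), norm_div (H z)]
      exact div_lt_div_of_pos_right (hsp z hz) (norm_pos_iff.2 (Pne z hz))
    have h2 : ‖Q z - 1‖ ^ 2 < ‖Q z‖ ^ 2 := by gcongr
    rw [← Complex.normSq_eq_norm_sq, ← Complex.normSq_eq_norm_sq, Complex.normSq_apply,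
      Complex.normSq_apply] at h2
    simp at h2
    nlinarith
  have sP := aux_taylor P dP
  have sQ := aux_taylor Q dQ
  set p : ℕ → ℂ := fun n => (n.factorial : ℂ)⁻¹ * iteratedDeriv n P 0 with hp
  set q : ℕ → ℂ := fun n => (n.factorial : ℂ)⁻¹ * iteratedDeriv n Q 0 with hq
  have p0 : p 0 = 1 := by simp [hp, P0]
  have q0 : q 0 = 1 := by simp [hq, Q0]
  have bp : ∀ k, k ≠ 0 → ‖p k‖ ≤ 2 * (1 - α) := fun k hk =>
    aux_carath P dP α (fun z hz => (Pre z hz).le) P0 p sP k hk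
  have bq : ∀ k, ‖q k‖ ≤ 1 := by
    intro k
    by_cases hk : k = 0
    · rw [hk, q0]; simp
    · have := aux_carath Q dQ (1/2) Qre Q0 q sQ k hk
      linarith
  -- product
  have sH1 : ∀ z ∈ ball (0:ℂ) 1,
      HasSum (fun n => (∑ k ∈ Finset.range (n+1), p k * q (n - k)) * z ^ n) (H z) := by
    intro z hz
    have := hasSum_sum_range_mul_of_summable_norm (sP z hz).summable.norm (sQ z hz).summable.norm
    rw [(sP z hz).tsum_eq, (sQ z hz).tsum_eq] at this
    have e : P z * Q z = H z := by
      rw [hQ]; dsimp only; field_simp [Pne z hz]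
    rw [e] at this
    convert! this using 2 with m
    rw [Finset.sum_mul]
    refine Finset.sum_congr rfl fun k hk => ?_
    have : k + (m - k) = m := by simp at hk; omega
    change _ = (p k * z ^ k) * (q (m-k) * z ^ (m-k))
    rw [mul_mul_mul_comm (p k), ← pow_add, this]
  -- log
  choose! A hA using hha
  have sA : ∀ z ∈ ball (0:ℂ) 1, HasSum (fun n => a n * z ^ n) (A z) := fun z hz => (hA z hz).1
  have fpA : HasFPowerSeriesOnBall A (FormalMultilinearSeries.ofScalars ℂ a) 0 1 := by
    refine ⟨?_, one_pos, ?_⟩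
    · refine le_of_forall_lt fun r hr => ?_
      obtain ⟨s, hs, hs'⟩ := ENNReal.lt_iff_exists_nnreal_btwn.1 hr
      refine hs.trans_le (FormalMultilinearSeries.le_radius_of_summable_norm _ ?_)
      have := (sA (s : ℂ) (by simpa using hs')).summable.norm
      simpa [FormalMultilinearSeries.ofScalars_norm] using this
    · intro y hy
      have hy' : y ∈ ball (0:ℂ) 1 := by
        rwa [← ENNReal.ofReal_one, Metric.eball_ofReal] at hy
      have := sA y hy'
      simpa [FormalMultilinearSeries.ofScalars_apply_eq, mul_comm] using this
  have dA : DifferentiableOn ℂ A (ball 0 1) := by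
    have := fpA.differentiableOn
    rwa [← ENNReal.ofReal_one, Metric.eball_ofReal] at this
  have ddA : DifferentiableOn ℂ (deriv A) (ball 0 1) := dA.deriv isOpen_ball
  have hAd : ∀ z ∈ ball (0:ℂ) 1, deriv h z / h z = deriv A z := by
    intro z hz
    have hnh := isOpen_ball.mem_nhds hz
    have : h =ᶠ[nhds z] fun z => Complex.exp (A z) := by
      filter_upwards [hnh] with w hw using (hA w hw).2
    rw [this.deriv_eq, (hA z hz).2, deriv_cexp (dA.differentiableAt hnh)]
    field_simp [Complex.exp_ne_zero]
  have an : ∀ k, a k = (k.factorial : ℂ)⁻¹ * iteratedDeriv k A 0 :=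
    aux_unique2 A _ _ sA (aux_taylor A dA)
  have sdA := aux_taylor (deriv A) ddA
  have sH2 : ∀ z ∈ ball (0:ℂ) 1,
      HasSum (fun n => ((if n = 0 then 1 else 0) + n * a n) * z ^ n) (H z) := by
    intro z hz
    have h1 := (sdA z hz).mul_left z
    rw [← hasSum_nat_add_iff' 1]
    have e : H z = 1 + z * deriv A z := by
      simp only [hH, mul_div_assoc, hAd z hz]
    rw [e]
    convert! h1 using 1
    · ext m
      rw [an (m+1), iteratedDeriv_succ', Nat.factorial_succ]
      have : (m:ℂ) + 1 ≠ 0 := by exact_mod_cast m.succ_ne_zero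
      have h3 : (m.factorial:ℂ) ≠ 0 := by exact_mod_cast m.factorial_ne_zero
      push_cast
      simp
      field_simp
      ring
    · simp
  have key := aux_unique2 H _ _ sH2 sH1 n
  simp only [hn0, if_false, zero_add] at key
  have bound : (n:ℝ) * ‖a n‖ ≤ 1 + n * (2 * (1 - α)) := by
    have e : (n:ℝ) * ‖a n‖ = ‖(n:ℂ) * a n‖ := by simp
    rw [e, key, Finset.sum_range_succ']
    refine (norm_add_le _ _).trans ?_
    have h1 : ‖∑ k ∈ Finset.range n, p (k+1) * q (n - (k+1))‖ ≤ ∑ k ∈ Finset.range n, 2 * (1 - α) := by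
      refine norm_sum_le_of_le _ fun k _ => ?_
      rw [norm_mul]
      have := bp (k+1) (by omega)
      calc _ ≤ 2 * (1-α) * 1 := mul_le_mul this (bq _) (norm_nonneg _) (by linarith)
        _ = _ := by ring
    have h2 : ‖p 0 * q (n - 0)‖ ≤ 1 := by rw [p0, one_mul]; exact bq _
    simp only [Finset.sum_const, Finset.card_range, nsmul_eq_mul] at h1
    linarith
  have hnp : (0:ℝ) < n := by exact_mod_cast hn
  have : ‖a n‖ ≤ (1 + n * (2 * (1 - α))) / n := by
    rw [le_div_iff₀ hnp]; linarith
  refine this.trans (le_of_eq ?_)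
  field_simp
  ring
end

section
/- Let 0 ≤ α < 1 and let f(z) = z·h(z)·conj(g(z)) belong to S*_Lh(α), with g(z) = exp(Σ_{n≥1} bₙ zⁿ). Then |bₙ| ≤ 2(1−α) + (2α−1)/n for every integer n ≥ 1. -/
open Complex Metric

noncomputable def TC (f : ℂ → ℂ) (n : ℕ) : ℂ := iteratedDeriv n f 0 / n.factorial

lemma TC_mul {f g : ℂ → ℂ} (hf : AnalyticAt ℂ f 0) (hg : AnalyticAt ℂ g 0) (n : ℕ) :
    TC (fun z => f z * g z) n = ∑ i ∈ Finset.range (n+1), TC f i * TC g (n - i) := by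
  unfold TC
  rw [iteratedDeriv_fun_mul hf.contDiffAt hg.contDiffAt, Finset.sum_div]
  refine Finset.sum_congr rfl fun i hi => ?_
  have hi : i ≤ n := by simpa [Nat.lt_succ_iff] using hi
  rw [Nat.cast_choose ℂ hi]
  have h1 : (n.factorial : ℂ) ≠ 0 := by exact_mod_cast n.factorial_ne_zero
  have h2 : (i.factorial : ℂ) ≠ 0 := by exact_mod_cast i.factorial_ne_zero
  have h3 : ((n-i).factorial : ℂ) ≠ 0 := by exact_mod_cast (n-i).factorial_ne_zero
  field_simp

lemma TC_zmul {f : ℂ → ℂ} (hf : AnalyticAt ℂ f 0) (n : ℕ) :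
    TC (fun z => z * deriv f z) n = n * TC f n := by
  rw [TC_mul (f := fun z => z) analyticAt_id hf.deriv]
  have key : ∀ i, TC (fun z => z) i = if i = 1 then 1 else 0 := by
    intro i
    match i with
    | 0 => simp [TC]
    | 1 => simp [TC]
    | (k+2) => simp [TC, iteratedDeriv_succ', iteratedDeriv_const]
  simp only [key, id]
  rcases n with _ | n
  · simp
  · rw [Finset.sum_eq_single 1 (fun b _ hb => by simp [hb]) (by simp)]
    simp only [TC, iteratedDeriv_succ', Nat.factorial_succ]
    have h1 : (n.factorial : ℂ) ≠ 0 := by exact_mod_cast n.factorial_ne_zero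
    have h2 : (n+1 : ℂ) ≠ 0 := by exact_mod_cast n.succ_ne_zero
    push_cast
    simp
    field_simp

lemma TC_of_series {f : ℂ → ℂ} {b : ℕ → ℂ}
    (hf : HasFPowerSeriesAt f (FormalMultilinearSeries.ofScalars ℂ b) 0) (n : ℕ) : TC f n = b n := by
  have h1 := hf.analyticAt.hasFPowerSeriesAt
  have := hf.eq_formalMultilinearSeries h1
  rw [FormalMultilinearSeries.ofScalars_series_eq_iff] at this
  exact (congrFun this n).symm

lemma cara_r {q : ℂ → ℂ} (hq : DifferentiableOn ℂ q (ball 0 1))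
    (hre : ∀ z ∈ ball (0:ℂ) 1, 0 ≤ (q z).re) (n : ℕ) (hn : 1 ≤ n) (r : ℝ) (h0 : 0 < r) (h1 : r < 1) :
    ‖TC q n‖ * r ^ n ≤ 2 * (q 0).re := by
  have hsub : closedBall (0:ℂ) r ⊆ ball 0 1 := closedBall_subset_ball h1
  have hd : DifferentiableOn ℂ q (closedBall 0 r) := hq.mono hsub
  have hcirc : ∀ θ, circleMap 0 r θ ∈ closedBall (0:ℂ) r := fun θ => by
    simpa using circleMap_mem_closedBall (0:ℂ) h0.le θ
  have hcq : Continuous fun θ : ℝ => q (circleMap 0 r θ) :=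
    hd.continuousOn.comp_continuous (continuous_circleMap 0 r) hcirc
  have hcm : Continuous fun θ : ℝ => circleMap 0 r θ := continuous_circleMap 0 r
  have hne : ∀ θ, circleMap 0 r θ ≠ 0 := fun θ => circleMap_ne_center h0.ne'
  have hdc : ∀ f : ℂ → ℂ, DifferentiableOn ℂ f (closedBall 0 r) →
      ∫ θ in (0:ℝ)..2 * Real.pi, f (circleMap 0 r θ) = 2 * Real.pi * f 0 := by
    intro f hf
    have : DiffContOnCl ℂ f (ball 0 |r|) := by
      rw [abs_of_pos h0]
      exact hf.diffContOnCl_ball subset_rfl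
    have := this.circleAverage
    rw [Real.circleAverage_def] at this
    rw [← this, real_smul]
    push_cast
    have : (Real.pi : ℂ) ≠ 0 := by exact_mod_cast Real.pi_ne_zero
    field_simp
  have e1 : ∫ θ in (0:ℝ)..2 * Real.pi, q (circleMap 0 r θ) / (circleMap 0 r θ)^n
      = 2 * Real.pi * TC q n := by
    have := hd.circleIntegral_one_div_sub_center_pow_smul h0 n
    rw [circleIntegral] at this
    simp only [deriv_circleMap, sub_zero, smul_eq_mul] at this
    have e : ∀ θ : ℝ, circleMap 0 r θ * I * (1 / circleMap 0 r θ ^ (n+1) * q (circleMap 0 r θ))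
        = I * (q (circleMap 0 r θ) / (circleMap 0 r θ)^n) := by
      intro θ
      have := hne θ
      rw [pow_succ]
      field_simp
    simp only [e, intervalIntegral.integral_const_mul] at this
    apply mul_left_cancel₀ I_ne_zero
    rw [this, TC]; ring
  have e2 : ∫ θ in (0:ℝ)..2 * Real.pi, (starRingEnd ℂ) (q (circleMap 0 r θ)) / (circleMap 0 r θ)^n
      = 0 := by
    have := hdc (fun z => z^n * q z) (by fun_prop)
    simp only [zero_pow (by omega : n ≠ 0), zero_mul, mul_zero] at this
    have h2 : ∫ θ in (0:ℝ)..2 * Real.pi, (starRingEnd ℂ) (circleMap 0 r θ ^ n * q (circleMap 0 r θ)) = 0 := by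
      rw [intervalIntegral.intervalIntegral_conj, this, map_zero]
    have e : ∀ θ : ℝ, (starRingEnd ℂ) (q (circleMap 0 r θ)) / (circleMap 0 r θ)^n =
       ((r:ℂ)^(2*n))⁻¹ * (starRingEnd ℂ) (circleMap 0 r θ ^ n * q (circleMap 0 r θ)) := by
      intro θ
      have hz := hne θ
      have hr : (r:ℂ)^2 = (starRingEnd ℂ) (circleMap 0 r θ) * circleMap 0 r θ := by
        rw [conj_mul', norm_circleMap_zero, abs_of_pos h0]
      have hz' : (starRingEnd ℂ) (circleMap 0 r θ) ≠ 0 := by simpa using hz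
      rw [pow_mul, hr, map_mul, map_pow, mul_pow]
      field_simp
    simp only [e, intervalIntegral.integral_const_mul, h2, mul_zero]
  have e3 : ∫ θ in (0:ℝ)..2 * Real.pi, ((2 * (q (circleMap 0 r θ)).re : ℝ) : ℂ) / (circleMap 0 r θ)^n
      = 2 * Real.pi * TC q n := by
    have e12 := congrArg₂ (· + ·) e1 e2
    simp only [add_zero] at e12
    rw [← e12, ← intervalIntegral.integral_add]
    · congr 1; ext θ
      rw [← add_div, add_conj]
    · exact (hcq.div (hcm.pow n) fun θ => pow_ne_zero _ (hne θ)).intervalIntegrable _ _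
    · exact ((continuous_conj.comp hcq).div (hcm.pow n) fun θ => pow_ne_zero _ (hne θ)).intervalIntegrable _ _
  have e4 : ∫ θ in (0:ℝ)..2 * Real.pi, (q (circleMap 0 r θ)).re = 2 * Real.pi * (q 0).re := by
    have h := congrArg re (hdc q hd)
    have h' := reCLM.intervalIntegral_comp_comm (hcq.intervalIntegrable (μ := MeasureTheory.volume) 0 (2 * Real.pi))
    simp only [reCLM_apply] at h'
    rw [h', h]
    simp [mul_re]
  have hb : ‖2 * Real.pi * TC q n‖ ≤ ∫ θ in (0:ℝ)..2 * Real.pi, 2 * (q (circleMap 0 r θ)).re / r^n := by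
    rw [← e3]
    refine (intervalIntegral.norm_integral_le_integral_norm (by positivity)).trans (le_of_eq ?_)
    congr 1; ext θ
    have := hre _ (hsub (hcirc θ))
    rw [norm_div, norm_pow, norm_circleMap_zero, abs_of_pos h0, norm_real, Real.norm_of_nonneg (by positivity)]
  have e5 : ∫ θ in (0:ℝ)..2 * Real.pi, 2 * (q (circleMap 0 r θ)).re / r^n = 2 * (2 * Real.pi * (q 0).re) / r^n := by
    rw [intervalIntegral.integral_div, intervalIntegral.integral_const_mul, e4]
  rw [e5, norm_mul, norm_mul, norm_real, Real.norm_of_nonneg Real.pi_pos.le, le_div_iff₀ (by positivity)] at hb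
  simp only [norm_ofNat] at hb
  have := Real.pi_pos
  have : (2 * Real.pi) * (‖TC q n‖ * r ^ n) ≤ (2 * Real.pi) * (2 * (q 0).re) := by linarith
  exact le_of_mul_le_mul_left this (by positivity)

lemma cara {q : ℂ → ℂ} (hq : DifferentiableOn ℂ q (ball 0 1))
    (hre : ∀ z ∈ ball (0:ℂ) 1, 0 ≤ (q z).re) (n : ℕ) (hn : 1 ≤ n) :
    ‖TC q n‖ ≤ 2 * (q 0).re := by
  have ht : Filter.Tendsto (fun r : ℝ => ‖TC q n‖ * r ^ n) (nhdsWithin 1 (Set.Iio 1)) (nhds (‖TC q n‖ * 1 ^ n)) :=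
    Filter.Tendsto.mono_left (Continuous.tendsto (by fun_prop) _) nhdsWithin_le_nhds
  rw [one_pow, mul_one] at ht
  refine le_of_tendsto ht ?_
  filter_upwards [Ioo_mem_nhdsLT (zero_lt_one' ℝ)] with r hr
  exact cara_r hq hre n hn r hr.1 hr.2

lemma TC_affine {f : ℂ → ℂ} (c d : ℂ) (n : ℕ) (hn : 1 ≤ n) (hf : AnalyticAt ℂ f 0) :
    TC (fun z => d + c * f z) n = c * TC f n := by
  unfold TC
  have h1 : AnalyticAt ℂ (fun z => c * f z) 0 := analyticAt_const.mul hf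
  rw [iteratedDeriv_fun_add contDiffAt_const h1.contDiffAt, iteratedDeriv_const, if_neg (by omega),
    iteratedDeriv_const_mul_field]
  ring

theorem stmt_6 (α : ℝ) (hα0 : 0 ≤ α) (hα1 : α < 1)
    (h g : ℂ → ℂ)
    (hh : DifferentiableOn ℂ h (ball 0 1))
    (hg : DifferentiableOn ℂ g (ball 0 1))
    (hh0 : h 0 = 1) (hg0 : g 0 = 1)
    (hhne : ∀ z ∈ ball (0:ℂ) 1, h z ≠ 0)
    (hgne : ∀ z ∈ ball (0:ℂ) 1, g z ≠ 0)
    (hsp : ∀ z ∈ ball (0:ℂ) 1,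
      ‖z * deriv g z / g z‖ < ‖1 + z * deriv h z / h z‖)
    (hinj : Set.InjOn (fun z => z * h z * (starRingEnd ℂ) (g z)) (ball 0 1))
    (hstar : ∀ z ∈ ball (0:ℂ) 1, z ≠ 0 →
      α < (1 + z * deriv h z / h z - (starRingEnd ℂ) (z * deriv g z / g z)).re)
    (b : ℕ → ℂ) (hb0 : b 0 = 0)
    (hgb : ∀ z ∈ ball (0:ℂ) 1, ∃ w : ℂ,
      HasSum (fun n => b n * z ^ n) w ∧ g z = Complex.exp w) :
    ∀ n : ℕ, 1 ≤ n → ‖b n‖ ≤ 2 * (1 - α) + (2 * α - 1) / n := by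
  intro n hn
  set G : ℂ → ℂ := fun z => z * deriv g z / g z with hG
  set H : ℂ → ℂ := fun z => 1 + z * deriv h z / h z with hH
  set p : ℂ → ℂ := fun z => H z - G z with hp
  have hball : ball (0:ℂ) 1 ∈ nhds 0 := ball_mem_nhds 0 one_pos
  have hdG : DifferentiableOn ℂ G (ball 0 1) :=
    (differentiableOn_id.mul (hg.deriv isOpen_ball)).div hg hgne
  have hdH : DifferentiableOn ℂ H (ball 0 1) :=
    ((differentiableOn_id.mul (hh.deriv isOpen_ball)).div hh hhne).const_add 1
  have hdp : DifferentiableOn ℂ p (ball 0 1) := hdH.sub hdG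
  have hp0 : p 0 = 1 := by simp [hp, hH, hG]
  have hpre : ∀ z ∈ ball (0:ℂ) 1, α < (p z).re := by
    intro z hz
    by_cases h0 : z = 0
    · rw [h0, hp0]; simpa using hα1
    · have := hstar z hz h0
      simp only [sub_re, conj_re] at this
      simpa only [hp, sub_re, hH, hG] using this
  have hpne : ∀ z ∈ ball (0:ℂ) 1, p z ≠ 0 := by
    intro z hz h0
    have := hpre z hz
    rw [h0] at this
    simp at this; linarith
  set m : ℂ → ℂ := fun z => G z / p z with hm
  have hdm : DifferentiableOn ℂ m (ball 0 1) := hdG.div hdp hpne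
  have hm0 : m 0 = 0 := by simp [hm, hG]
  have ha : ∀ {f : ℂ → ℂ}, DifferentiableOn ℂ f (ball 0 1) → AnalyticAt ℂ f 0 :=
    fun hf => hf.analyticAt hball
  -- coefficient bounds
  have hpc : ∀ k, 1 ≤ k → ‖TC p k‖ ≤ 2 * (1 - α) := by
    intro k hk
    have := cara (q := fun z => (-α:ℂ) + 1 * p z) (by fun_prop) (by
      intro z hz
      have := hpre z hz
      simp; linarith) k hk
    rw [TC_affine _ _ k hk (ha hdp), one_mul, hp0] at this
    simp at this
    linarith
  have hmc : ∀ k, 1 ≤ k → ‖TC m k‖ ≤ 1 := by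
    intro k hk
    have := cara (q := fun z => (1:ℂ) + 2 * m z) (by fun_prop) (by
      intro z hz
      have hne := hpne z hz
      have hlt : ‖G z‖ < ‖H z‖ := hsp z hz
      have e : (1:ℂ) + 2 * m z = (H z + G z) / (H z - G z) := by
        have : H z - G z ≠ 0 := hne
        simp only [hm, hp]
        field_simp
        ring
      simp only [e, div_re]
      rw [← add_div]
      apply div_nonneg _ (normSq_nonneg _)
      have h2 : normSq (G z) ≤ normSq (H z) := by
        rw [normSq_eq_norm_sq, normSq_eq_norm_sq]; gcongr
      simp only [normSq_apply] at h2
      simp only [add_re, sub_re, add_im, sub_im]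
      nlinarith) k hk
    rw [TC_affine _ _ k hk (ha hdm), hm0, norm_mul] at this
    simp at this
    exact this
  -- the series
  choose! B hB using hgb
  have hBs : HasFPowerSeriesAt B (FormalMultilinearSeries.ofScalars ℂ b) 0 := by
    rw [hasFPowerSeriesAt_iff]
    filter_upwards [hball] with z hz
    simpa [mul_comm, FormalMultilinearSeries.coeff_ofScalars] using (hB z hz).1
  have hGB : G =ᶠ[nhds 0] fun z => z * deriv B z := by
    filter_upwards [hball, hBs.analyticAt.eventually_analyticAt] with z hz hBz
    have : g =ᶠ[nhds z] fun z => exp (B z) := by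
      filter_upwards [isOpen_ball.mem_nhds hz] with w hw using (hB w hw).2
    simp only [hG]
    rw [this.deriv_eq, this.eq_of_nhds, (hBz.differentiableAt.hasDerivAt.cexp).deriv]
    have := exp_ne_zero (B z)
    field_simp
  have hGm : G =ᶠ[nhds 0] fun z => p z * m z := by
    filter_upwards [hball] with z hz
    simp only [hm]
    have := hpne z hz
    field_simp
  have key : (n:ℂ) * b n = ∑ i ∈ Finset.range (n+1), TC p i * TC m (n - i) := by
    rw [← TC_mul (ha hdp) (ha hdm), ← TC_of_series hBs, ← TC_zmul hBs.analyticAt, TC, TC,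
      ← hGB.iteratedDeriv_eq, hGm.iteratedDeriv_eq]
  have hTm0 : TC m 0 = 0 := by simp [TC, hm0]
  have hTp0 : TC p 0 = 1 := by simp [TC, hp0]
  have hbound : ‖(n:ℂ) * b n‖ ≤ 1 + (n - 1) * (2 * (1 - α)) := by
    obtain ⟨k, rfl⟩ : ∃ k, n = k + 1 := ⟨n - 1, by omega⟩
    rw [key, Finset.sum_range_succ, Nat.sub_self, hTm0, mul_zero, add_zero, Finset.sum_range_succ',
      hTp0, one_mul, add_comm]
    refine (norm_add_le _ _).trans (add_le_add (hmc _ (by omega)) ?_)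
    refine (norm_sum_le_of_le (f := fun i => TC p (i+1) * TC m (k + 1 - (i+1))) (n := fun _ => 2 * (1 - α)) _ ?_).trans ?_
    · intro i hi
      have hi : i < k := by simpa using hi
      rw [norm_mul]
      have h1 := hpc (i+1) (by omega)
      have h2 := hmc (k + 1 - (i+1)) (by omega)
      nlinarith [norm_nonneg (TC p (i+1)), norm_nonneg (TC m (k + 1 - (i+1)))]
    · simp
  have hnpos : (0:ℝ) < n := by exact_mod_cast hn
  rw [norm_mul, Complex.norm_natCast] at hbound
  have : 2 * (1 - α) + (2 * α - 1) / n = (1 + (n - 1) * (2 * (1 - α))) / n := by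
    field_simp; ring
  rw [this, le_div_iff₀ hnpos]
  linarith
end

section
/- Let 0 ≤ α < 1, let f(z) = z·h(z)·conj(g(z)) belong to S*_Lh(α) with h(z) = exp(Σ_{n≥1} aₙ zⁿ), and set H(z) = z·h(z). If 0 ≤ r < 1 satisfies (r/(1−r))·exp(2(1−α)r/(1−r)) ≤ 1/(2·e^{1−α}), then r·exp(Σ_{n≥1} |aₙ| rⁿ) ≤ d(0, ∂(H(𝔻))). -/
open Complex Metric

lemma cara_aux (P : ℂ → ℂ) (hP : DifferentiableOn ℂ P (ball 0 1)) (hP0 : P 0 = 1)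
    (hre : ∀ z ∈ ball (0:ℂ) 1, 0 < (P z).re) (n : ℕ) (hn : n ≠ 0) (ρ : ℝ) (hρ0 : 0 < ρ) (hρ1 : ρ < 1)
    (l : ℂ) (hl : ‖l‖ = 1) :
    0 ≤ 2 + (l * (iteratedDeriv n P 0 / n.factorial) * ρ ^ n).re := by
  have hsub : closedBall (0:ℂ) ρ ⊆ ball 0 1 := closedBall_subset_ball hρ1
  have hPc : DifferentiableOn ℂ P (closedBall 0 ρ) := hP.mono hsub
  have hsp : sphere (0:ℂ) |ρ| ⊆ closedBall 0 ρ := by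
    rw [abs_of_pos hρ0]; exact sphere_subset_closedBall
  have hz0 : ∀ z ∈ sphere (0:ℂ) |ρ|, z ≠ 0 := by
    intro z hz h0
    simp [h0] at hz; rw [abs_of_pos hρ0] at hz; exact hρ0.ne hz
  have hcP : ContinuousOn P (sphere 0 |ρ|) := hPc.continuousOn.mono hsp
  have avg0 : Real.circleAverage P 0 ρ = 1 := by
    rw [DiffContOnCl.circleAverage, hP0]
    rw [abs_of_pos hρ0]
    exact (hPc.mono closure_ball_subset_closedBall).diffContOnCl
  have avg1 : Real.circleAverage (fun z => P z * z ^ n) 0 ρ = 0 := by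
    rw [DiffContOnCl.circleAverage, hP0]
    · simp [hn]
    rw [abs_of_pos hρ0]
    refine DifferentiableOn.diffContOnCl ?_
    exact (hPc.mono closure_ball_subset_closedBall).mul (by fun_prop)
  have avg2 : Real.circleAverage (fun z => (z ^ n)⁻¹ * P z) 0 ρ = iteratedDeriv n P 0 / n.factorial := by
    rw [Real.circleAverage_eq_circleIntegral hρ0.ne']
    have := DifferentiableOn.circleIntegral_one_div_sub_center_pow_smul hρ0 n hPc
    have h2 : (∮ z in C(0, ρ), (z - 0)⁻¹ • ((z ^ n)⁻¹ * P z)) = ∮ z in C(0, ρ), (1 / (z - 0) ^ (n + 1)) • P z := by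
      congr 1; ext z; simp [pow_succ]; ring
    rw [h2, this]
    have : (2 * (Real.pi:ℂ) * I) ≠ 0 := two_pi_I_ne_zero
    simp only [smul_eq_mul]
    field_simp
  have i0 : CircleIntegrable P 0 ρ := by
    apply ContinuousOn.circleIntegrable'; exact hcP
  have i1 : CircleIntegrable (fun z => P z * z ^ n) 0 ρ := by
    apply ContinuousOn.circleIntegrable'; exact hcP.mul (by fun_prop)
  have i2 : CircleIntegrable (fun z => (z ^ n)⁻¹ * P z) 0 ρ := by
    apply ContinuousOn.circleIntegrable'
    refine ContinuousOn.mul (ContinuousOn.inv₀ (by fun_prop) fun z hz => pow_ne_zero _ (hz0 z hz)) hcP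
  set c := iteratedDeriv n P 0 / n.factorial with hc
  set Q : ℂ → ℂ := fun z => (2:ℂ) • P z + ((l * ρ ^ n) • ((z ^ n)⁻¹ * P z) +
      ((starRingEnd ℂ) l * (ρ ^ n : ℂ)⁻¹) • (P z * z ^ n)) with hQ
  have iQ : CircleIntegrable Q 0 ρ := by
    have j0 := i0.const_fun_smul (a := (2:ℂ))
    have j1 := i2.const_fun_smul (a := l * ρ ^ n)
    have j2 := i1.const_fun_smul (a := (starRingEnd ℂ) l * (ρ ^ n : ℂ)⁻¹)
    exact j0.add (j1.add j2)
  have aQ : Real.circleAverage Q 0 ρ = 2 + l * c * ρ ^ n := by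
    have j0 := i0.const_fun_smul (a := (2:ℂ))
    have j1 := i2.const_fun_smul (a := l * ρ ^ n)
    have j2 := i1.const_fun_smul (a := (starRingEnd ℂ) l * (ρ ^ n : ℂ)⁻¹)
    have j12 : CircleIntegrable (fun z => (l * ρ ^ n) • ((z ^ n)⁻¹ * P z) +
      ((starRingEnd ℂ) l * (ρ ^ n : ℂ)⁻¹) • (P z * z ^ n)) 0 ρ := j1.add j2
    rw [hQ, Real.circleAverage_fun_add j0 j12, Real.circleAverage_fun_add j1 j2,
      Real.circleAverage_fun_smul, Real.circleAverage_fun_smul, Real.circleAverage_fun_smul, avg0, avg1, avg2]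
    simp only [smul_eq_mul]; ring
  have hre2 := Complex.reCLM.circleAverage_comp_comm iQ
  rw [aQ] at hre2
  have : (0:ℝ) ≤ Real.circleAverage (reCLM ∘ Q) 0 ρ := by
    apply Real.circleAverage_nonneg_of_nonneg
    intro z hz
    have hzn : ‖z‖ = ρ := by rw [abs_of_pos hρ0] at hz; simpa using hz
    have hPz := hre z (hsub (hsp hz))
    set t : ℂ := l * ρ ^ n * (z ^ n)⁻¹ with ht
    have htn : ‖t‖ = 1 := by
      simp [ht, hl, hzn, abs_of_pos hρ0, hρ0.ne']
    have hconj : (starRingEnd ℂ) l * (ρ ^ n : ℂ)⁻¹ * z ^ n = (starRingEnd ℂ) t := by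
      have h1 : (starRingEnd ℂ) t = t⁻¹ := by
        rw [Complex.inv_def, Complex.normSq_eq_norm_sq, htn]; simp
      have h2 : (starRingEnd ℂ) l = l⁻¹ := by
        rw [Complex.inv_def, Complex.normSq_eq_norm_sq, hl]; simp
      rw [h1, h2, ht]; simp; ring
    have hQz : Q z = (2 + (t + (starRingEnd ℂ) t)) * P z := by
      rw [← hconj, ht, hQ]; simp only [smul_eq_mul]; ring
    have habs := Complex.abs_re_le_norm t
    rw [htn] at habs
    have := (abs_le.1 habs).1
    simp only [Function.comp, reCLM_apply, hQz]
    rw [Complex.add_conj]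
    simp
    have : 0 ≤ 2 + 2 * t.re := by linarith
    positivity
  rw [hre2] at this
  simpa using this

lemma cara_s7 (P : ℂ → ℂ) (hP : DifferentiableOn ℂ P (ball 0 1)) (hP0 : P 0 = 1)
    (hre : ∀ z ∈ ball (0:ℂ) 1, 0 < (P z).re) (n : ℕ) (hn : n ≠ 0) :
    ‖iteratedDeriv n P 0 / n.factorial‖ ≤ 2 := by
  set c := iteratedDeriv n P 0 / n.factorial with hc
  by_cases h0 : c = 0
  · simp [h0]
  have key : ∀ ρ : ℝ, 0 < ρ → ρ < 1 → ‖c‖ * ρ ^ n ≤ 2 := by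
    intro ρ h1 h2
    have hcn : (‖c‖:ℂ) ≠ 0 := by simpa using h0
    have := cara_aux P hP hP0 hre n hn ρ h1 h2 (-((starRingEnd ℂ) c / ‖c‖)) (by
      simp [h0])
    rw [← hc] at this
    have e : (-((starRingEnd ℂ) c / ‖c‖)) * c * (ρ:ℂ) ^ n = ((-(‖c‖ * ρ ^ n) : ℝ) : ℂ) := by
      have : (starRingEnd ℂ) c * c = (‖c‖:ℂ) ^ 2 := Complex.conj_mul' c
      push_cast
      field_simp
      rw [← this]
    rw [e, Complex.ofReal_re] at this
    linarith
  have ht : Filter.Tendsto (fun ρ : ℝ => ‖c‖ * ρ ^ n) (nhdsWithin 1 (Set.Iio 1)) (nhds (‖c‖ * 1 ^ n)) := by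
    apply Filter.Tendsto.mono_left _ nhdsWithin_le_nhds
    exact Continuous.tendsto (by fun_prop) 1
  have := le_of_tendsto ht (by
    filter_upwards [Ioo_mem_nhdsLT (show (0:ℝ) < 1 by norm_num)] with ρ hρ
    exact key ρ hρ.1 hρ.2)
  simpa using this

lemma psA (a : ℕ → ℂ) (hs : ∀ z ∈ ball (0:ℂ) 1, Summable (fun n => a n * z ^ n)) :
    HasFPowerSeriesOnBall (fun z => ∑' n, a n * z ^ n) (FormalMultilinearSeries.ofScalars ℂ a) 0 1 := by
  refine ⟨?_, by norm_num, ?_⟩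
  · refine ENNReal.le_of_forall_nnreal_lt fun ρ hρ => ?_
    have hρ1 : (ρ:ℝ) < 1 := by exact_mod_cast hρ
    apply FormalMultilinearSeries.le_radius_of_summable_norm
    have := (hs (ρ:ℂ) (by simpa using hρ1)).norm
    simpa using this
  · intro y hy
    have hy1 : y ∈ ball (0:ℂ) 1 := by
      rw [mem_ball]; rw [Metric.mem_eball, edist_dist, ENNReal.ofReal_lt_one] at hy; exact hy
    have := (hs y hy1).hasSum
    simpa [FormalMultilinearSeries.ofScalars_apply_eq, smul_eq_mul, mul_comm] using this

lemma iterA (a : ℕ → ℂ) (hs : ∀ z ∈ ball (0:ℂ) 1, Summable (fun n => a n * z ^ n)) (n : ℕ) :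
    iteratedDeriv n (fun z => ∑' n, a n * z ^ n) 0 / n.factorial = a n := by
  have h1 := (psA a hs).hasFPowerSeriesAt
  have h2 := h1.analyticAt.hasFPowerSeriesAt
  have h3 := h2.eq_formalMultilinearSeries h1
  exact congrFun (FormalMultilinearSeries.ofScalars_series_injective ℂ ℂ h3) n

lemma iter_zderiv (A : ℂ → ℂ) (hA : AnalyticAt ℂ A 0) (n : ℕ) (hn : n ≠ 0) :
    iteratedDeriv n (fun z => 1 + z * deriv A z) 0 = n * iteratedDeriv n A 0 := by
  obtain ⟨m, rfl⟩ := Nat.exists_eq_succ_of_ne_zero hn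
  rw [iteratedDeriv_const_add (Nat.succ_pos m)]
  rw [iteratedDeriv_fun_mul (f := fun z => z) contDiffAt_id hA.deriv.contDiffAt]
  rw [Finset.sum_eq_single 1]
  · rw [iteratedDeriv_fun_id_zero]
    simp [iteratedDeriv_succ']
  · intro b _ hb
    rw [iteratedDeriv_fun_id_zero]; simp [hb]
  · intro h; simp at h

lemma coef_mul (p c : ℂ → ℂ) (hp : AnalyticAt ℂ p 0) (hc : AnalyticAt ℂ c 0) (M : ℝ)
    (hp0 : p 0 = 1) (hpk : ∀ n : ℕ, n ≠ 0 → ‖iteratedDeriv n p 0 / n.factorial‖ ≤ M)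
    (hck : ∀ n : ℕ, ‖iteratedDeriv n c 0 / n.factorial‖ ≤ 1) (n : ℕ) :
    ‖iteratedDeriv n (fun z => p z * c z) 0 / n.factorial‖ ≤ 1 + M * n := by
  have e : iteratedDeriv n (fun z => p z * c z) 0 / n.factorial =
      ∑ i ∈ Finset.range (n + 1), (iteratedDeriv i p 0 / i.factorial) *
        (iteratedDeriv (n - i) c 0 / (n - i).factorial) := by
    rw [iteratedDeriv_fun_mul hp.contDiffAt hc.contDiffAt, Finset.sum_div]
    apply Finset.sum_congr rfl
    intro i hi
    have hi' : i ≤ n := by simpa [Nat.lt_succ_iff] using hi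
    have := Nat.choose_mul_factorial_mul_factorial hi'
    have h2 : (n.choose i : ℂ) * i.factorial * (n - i).factorial = n.factorial := by exact_mod_cast this
    have f1 : (i.factorial : ℂ) ≠ 0 := by exact_mod_cast i.factorial_ne_zero
    have f2 : ((n - i).factorial : ℂ) ≠ 0 := by exact_mod_cast (n-i).factorial_ne_zero
    have f3 : (n.factorial : ℂ) ≠ 0 := by exact_mod_cast n.factorial_ne_zero
    field_simp
    rw [← h2]; ring
  rw [e]
  refine (norm_sum_le _ _).trans ?_
  rw [Finset.sum_range_succ']
  have h0 : ‖iteratedDeriv 0 p 0 / (Nat.factorial 0 : ℂ) * (iteratedDeriv (n - 0) c 0 / (n - 0).factorial)‖ ≤ 1 := by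
    simpa [hp0] using hck n
  have h1 : ∑ i ∈ Finset.range n, ‖iteratedDeriv (i + 1) p 0 / ((i+1).factorial : ℂ) *
      (iteratedDeriv (n - (i + 1)) c 0 / (n - (i+1)).factorial)‖ ≤ ∑ i ∈ Finset.range n, M := by
    apply Finset.sum_le_sum
    intro i _
    rw [norm_mul]
    have := hpk (i+1) (by simp)
    have h3 := hck (n - (i+1))
    calc _ ≤ M * 1 := mul_le_mul this h3 (norm_nonneg _) ((norm_nonneg _).trans this)
      _ = M := mul_one M
  simp at h1
  simp at h0 ⊢
  linarith

/-- sum bound -/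
lemma sum_bound (a : ℕ → ℂ) (ha0 : a 0 = 0) (M : ℝ) (r : ℝ) (hr0 : 0 ≤ r) (hr1 : r < 1)
    (hs : Summable fun n => ‖a n‖ * r ^ n)
    (ha : ∀ n : ℕ, n ≠ 0 → n * ‖a n‖ ≤ 1 + M * n) :
    ∑' n : ℕ, ‖a n‖ * r ^ n ≤ M * r / (1 - r) - Real.log (1 - r) := by
  have h1 := Real.hasSum_pow_div_log_of_abs_lt_one (x := r) (by rw [abs_of_nonneg hr0]; exact hr1)
  have h2 := ((hasSum_geometric_of_lt_one hr0 hr1).mul_left (M * r))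
  have h3 := h2.add h1
  have hs' := (hasSum_nat_add_iff' 1).2 hs.hasSum
  simp [ha0] at hs'
  rw [show M * r / (1 - r) - Real.log (1 - r) = M * r * (1 - r)⁻¹ + -Real.log (1 - r) by ring]
  refine hasSum_le (fun n => ?_) hs' h3
  have := ha (n+1) (by simp)
  have hn : (0:ℝ) < n + 1 := by positivity
  push_cast at this
  have h5 : ‖a (n+1)‖ ≤ M + 1 / (n+1) := by
    rw [← sub_nonneg] at this ⊢
    have : M + 1 / ((n:ℝ)+1) - ‖a (n+1)‖ = (1 + M * (n+1) - (n+1) * ‖a (n+1)‖) / (n+1) := by field_simp; ring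
    rw [this]; positivity
  calc ‖a (n+1)‖ * r ^ (n+1) ≤ (M + 1/(n+1)) * r ^ (n+1) := by gcongr
    _ = _ := by rw [pow_succ]; ring

lemma descent (F : ℂ → ℝ) (hF : ContinuousOn F (ball 0 1))
    (hd : ∀ z ∈ ball (0:ℂ) 1, z ≠ 0 → ∃ q : ℂ, 0 < q.re ∧ ∃ d < 0,
      HasDerivAt (fun s : ℝ => F (z * exp (-(s * q)))) d 0)
    (z : ℂ) (hz : z ∈ ball (0:ℂ) 1) (ρ : ℝ) (hρ0 : 0 ≤ ρ) (hρ : ρ ≤ ‖z‖) :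
    ∃ z2 : ℂ, ‖z2‖ = ρ ∧ F z2 ≤ F z := by
  have hz1 : ‖z‖ < 1 := by simpa using hz
  have hK : IsCompact (closedBall (0:ℂ) ‖z‖ \ ball 0 ρ) := (isCompact_closedBall _ _).diff isOpen_ball
  have hzK : z ∈ closedBall (0:ℂ) ‖z‖ \ ball 0 ρ := by simp [hρ]
  have hsub : closedBall (0:ℂ) ‖z‖ \ ball 0 ρ ⊆ ball 0 1 := fun w hw => by
    have := hw.1; simp at this; simp; linarith
  obtain ⟨w, hw, hmin⟩ := hK.exists_isMinOn ⟨z, hzK⟩ (hF.mono hsub)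
  refine ⟨w, ?_, hmin hzK⟩
  by_contra hne
  have hw1 : ‖w‖ ≤ ‖z‖ := by simpa using hw.1
  have hw2 : ρ < ‖w‖ := lt_of_le_of_ne (by simpa using hw.2) (Ne.symm hne)
  have hw0 : w ≠ 0 := by intro h; simp [h] at hw2; linarith
  obtain ⟨q, hq, d, hd0, hder⟩ := hd w (hsub hw) hw0
  have h1 : ∀ᶠ s : ℝ in nhdsWithin (0:ℝ) (Set.Ioi 0), F (w * exp (-(s * q))) < F w := by
    have := hder.hasDerivWithinAt (s := Set.Ioi 0)
    rw [hasDerivWithinAt_iff_tendsto_slope' (by simp)] at this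
    filter_upwards [this.eventually (gt_mem_nhds hd0), self_mem_nhdsWithin] with s hs hs0
    have hs0 : 0 < s := hs0
    rw [slope_def_field] at hs
    simp at hs
    rw [div_neg_iff] at hs
    rcases hs with hs | hs
    · linarith [hs.2]
    · linarith [hs.1]
  have hn : ∀ s : ℝ, ‖w * exp (-(s * q))‖ = ‖w‖ * Real.exp (-(s * q.re)) := by
    intro s; rw [norm_mul, Complex.norm_exp]; simp
  have h2 : ∀ᶠ s : ℝ in nhdsWithin (0:ℝ) (Set.Ioi 0), ρ < ‖w‖ * Real.exp (-(s * q.re)) := by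
    have : Filter.Tendsto (fun s : ℝ => ‖w‖ * Real.exp (-(s * q.re))) (nhds 0) (nhds (‖w‖ * Real.exp (-(0 * q.re)))) :=
      Continuous.tendsto (by fun_prop) 0
    simp at this
    exact (this.mono_left nhdsWithin_le_nhds).eventually (lt_mem_nhds hw2)
  obtain ⟨s, h1, h2, h3⟩ := (h1.and (h2.and self_mem_nhdsWithin)).exists
  have h3 : 0 < s := h3
  have hmem : w * exp (-(s * q)) ∈ closedBall (0:ℂ) ‖z‖ \ ball 0 ρ := by
    refine ⟨?_, ?_⟩
    · rw [mem_closedBall_zero_iff, hn]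
      have : Real.exp (-(s * q.re)) ≤ 1 := by
        rw [Real.exp_le_one_iff]; have := mul_pos h3 hq; linarith
      nlinarith [norm_nonneg w]
    · rw [mem_ball_zero_iff, hn]; linarith
  have := hmin hmem
  simp only [Set.mem_ofPred_eq] at this
  linarith

lemma pathA (A : ℂ → ℂ) (z q : ℂ) (hA : DifferentiableAt ℂ A z) :
    HasDerivAt (fun s : ℝ => (A (z * exp (-(s * q)))).re) (-(z * deriv A z * q).re) 0 := by
  have h1 : HasDerivAt (fun s : ℂ => z * exp (-(s * q))) (-(z * q)) 0 := by
    have := ((((hasDerivAt_id (0:ℂ)).mul_const q).neg).cexp).const_mul z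
    exact this.congr_deriv (by simp)
  have h2 : HasDerivAt A (deriv A z) (z * exp (-((0:ℂ) * q))) := by simpa using hA.hasDerivAt
  have h3 := (h2.comp (0:ℂ) h1).real_of_complex
  refine h3.congr_deriv ?_
  rw [← Complex.neg_re]
  congr 1; ring

lemma pathN (z q : ℂ) : (fun s : ℝ => ‖z * exp (-(s * q))‖) = fun s => ‖z‖ * Real.exp (-(s * q.re)) := by
  funext s; rw [norm_mul, Complex.norm_exp]; simp

lemma pathN' (z q : ℂ) : HasDerivAt (fun s : ℝ => ‖z * exp (-(s * q))‖) (-(‖z‖ * q.re)) 0 := by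
  rw [pathN]
  have := ((((hasDerivAt_id (0:ℝ)).mul_const q.re).neg).exp).const_mul ‖z‖
  exact this.congr_deriv (by simp)

lemma E1 (m : ℂ) (ρ : ℝ) (hm : ‖m‖ ≤ ρ) (hρ : ρ < 1) : 1 / (1 + ρ) ≤ (1 / (1 - m)).re := by
  have h0 := norm_nonneg m
  have hx := (abs_le.1 (Complex.abs_re_le_norm m)).1
  have hx2 := (abs_le.1 (Complex.abs_re_le_norm m)).2
  have hsq := Complex.sq_norm m
  rw [Complex.normSq_apply] at hsq
  have e : (1 / (1 - m)).re = (1 - m.re) / ((1 - m.re)^2 + m.im ^2) := by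
    rw [one_div, Complex.inv_re, Complex.normSq_apply]; simp; ring
  have hpos : 0 < (1 - m.re)^2 + m.im ^2 := by
    have : 0 < 1 - m.re := by linarith
    positivity
  rw [e, div_le_div_iff₀ (by linarith) hpos]
  nlinarith

lemma E3 (p : ℂ) (hp : 0 < p.re) : (1 / p).re ≤ 1 / p.re := by
  have h0 : 0 < p.re * p.re + p.im * p.im := by nlinarith [mul_self_nonneg p.im]
  rw [one_div, Complex.inv_re, Complex.normSq_apply, div_le_div_iff₀ h0 hp]
  nlinarith [mul_self_nonneg p.im]

lemma E2 (P : ℂ → ℂ) (hP : DifferentiableOn ℂ P (ball 0 1)) (hP0 : P 0 = 1)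
    (hre : ∀ z ∈ ball (0:ℂ) 1, 0 < (P z).re) (z : ℂ) (hz : z ∈ ball (0:ℂ) 1) :
    (1 - ‖z‖) / (1 + ‖z‖) ≤ (P z).re := by
  have hne : ∀ z ∈ ball (0:ℂ) 1, P z + 1 ≠ 0 := by
    intro z hz h
    have := hre z hz
    have h2 := congrArg Complex.re h
    simp at h2; linarith
  have hz1 : ‖z‖ < 1 := by simpa using hz
  have := norm_le_norm_of_mapsTo_ball (f := fun z => (P z - 1) / (P z + 1)) (R := 1) (z := z)
    ((hP.sub_const 1).div (hP.add_const 1) hne) (by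
      intro w hw
      simp only [mem_closedBall_zero_iff, norm_div]
      apply div_le_one_of_le₀ _ (norm_nonneg _)
      rw [← sq_le_sq₀ (norm_nonneg _) (norm_nonneg _), Complex.sq_norm, Complex.sq_norm,
        Complex.normSq_apply, Complex.normSq_apply]
      have := hre w hw
      simp; nlinarith) (by simp [hP0]) hz1
  simp only [norm_div] at this
  rw [div_le_iff₀ (norm_pos_iff.2 (hne z hz))] at this
  have hpos := hre z hz
  have h4 : ‖P z - 1‖ ^ 2 ≤ ‖z‖ ^ 2 * ‖P z + 1‖ ^ 2 := by
    rw [← mul_pow]; gcongr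
  rw [Complex.sq_norm, Complex.sq_norm (P z + 1),
        Complex.normSq_apply, Complex.normSq_apply] at h4
  simp at h4
  have hn := norm_nonneg z
  set x := (P z).re
  set y := (P z).im
  set ρ := ‖z‖
  have h5 : (1 - x) ^ 2 ≤ (ρ * (x + 1)) ^ 2 := by
    have : 0 ≤ (1 - ρ ^ 2) * y ^ 2 := mul_nonneg (by nlinarith) (sq_nonneg _)
    nlinarith
  have h6 := abs_le_of_sq_le_sq h5 (by positivity)
  rw [div_le_iff₀ (by positivity)]
  linarith [le_abs_self (1 - x)]

lemma not_surj (h H : ℂ → ℂ) (hH : ∀ z, H z = z * h z) (hh : DifferentiableOn ℂ h (ball 0 1))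
    (hh0 : h 0 = 1) (hhne : ∀ z ∈ ball (0:ℂ) 1, h z ≠ 0)
    (hHd : DifferentiableOn ℂ H (ball 0 1))
    (hder : ∀ z ∈ ball (0:ℂ) 1, deriv H z ≠ 0)
    (hop : ∀ s ⊆ ball (0:ℂ) 1, IsOpen s → IsOpen (H '' s))
    (hmono : ∀ z ∈ ball (0:ℂ) 1, ∀ ρ : ℝ, 0 ≤ ρ → ρ ≤ ‖z‖ → ∃ z2 : ℂ, ‖z2‖ = ρ ∧ ‖H z2‖ ≤ ‖H z‖) :
    ∃ y, y ∉ H '' ball 0 1 := by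
  by_contra hsurj
  push Not at hsurj
  choose ψ hψb hψ using hsurj
  set K : ℝ → Set ℂ := fun R => {z | z ∈ ball (0:ℂ) 1 ∧ ‖H z‖ ≤ R} with hK
  have hH0 : H 0 = 0 := by simp [hH]
  have hcompact : ∀ R, Set.InjOn H (K R) → IsCompact (K R) := by
    intro R hinj
    have hmem : ∀ y ∈ closedBall (0:ℂ) R, ψ y ∈ K R := by
      intro y hy
      refine ⟨hψb y, ?_⟩
      rw [hψ]; simpa using hy
    have e : K R = ψ '' closedBall 0 R := by
      ext z; constructor
      · intro hz
        have hz' : H z ∈ closedBall (0:ℂ) R := by simpa using hz.2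
        exact ⟨H z, hz', hinj (hmem _ hz') hz (hψ _)⟩
      · rintro ⟨y, hy, rfl⟩
        exact hmem y hy
    rw [e]
    refine (isCompact_closedBall _ _).image_of_continuousOn ?_
    intro y hy
    rw [ContinuousWithinAt, Filter.tendsto_def]
    intro W hW
    have hW2 : W ∩ ball 0 1 ∈ nhds (ψ y) := Filter.inter_mem hW (isOpen_ball.mem_nhds (hψb y))
    obtain ⟨O, hO1, hO2, hO3⟩ := _root_.mem_nhds_iff.1 hW2
    have hopen := hop O (fun x hx => (hO1 hx).2) hO2
    have hy' : H '' O ∈ nhds y := hopen.mem_nhds ⟨ψ y, hO3, hψ y⟩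
    rw [mem_nhdsWithin_iff_exists_mem_nhds_inter]
    refine ⟨_, hy', ?_⟩
    rintro y' ⟨⟨x, hx, rfl⟩, hy'2⟩
    have : ψ (H x) = x := hinj (hmem _ hy'2) ⟨(hO1 hx).2, by simpa using hy'2⟩ (hψ _)
    show ψ (H x) ∈ W
    rw [this]; exact (hO1 hx).1
  have hradius : ∀ R, 0 ≤ R → Set.InjOn H (K R) → ∃ r', 0 < r' ∧ r' < 1 ∧ K R ⊆ ball 0 r' := by
    intro R hR hinj
    obtain ⟨r', h1, h2⟩ := exists_lt_subset_ball (hcompact R hinj).isClosed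
      (show K R ⊆ ball 0 1 from fun z hz => hz.1)
    refine ⟨r', ?_, h1, h2⟩
    have : (0:ℂ) ∈ K R := ⟨by simp, by simpa [hH0] using hR⟩
    simpa using h2 this
  have hle : ∀ R, 0 ≤ R → Set.InjOn H (K R) → R ≤ 1 := by
    intro R hR hinj
    rcases hR.eq_or_lt with h0 | hRpos
    · linarith
    obtain ⟨r', hr0, hr1, hsub⟩ := hradius R hR hinj
    have hd : DiffContOnCl ℂ (fun z => (h z)⁻¹) (ball 0 r') := by
      apply DifferentiableOn.diffContOnCl
      have hs : closure (ball (0:ℂ) r') ⊆ ball 0 1 :=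
        closure_ball_subset_closedBall.trans (closedBall_subset_ball hr1)
      exact (hh.mono hs).inv fun z hz => hhne z (hs hz)
    have := norm_le_of_forall_mem_frontier_norm_le isBounded_ball hd (C := R⁻¹) (z := 0) (by
      intro z hz
      rw [frontier_ball _ hr0.ne', mem_sphere_zero_iff_norm] at hz
      rw [norm_inv]
      apply inv_anti₀ hRpos
      have hzn : z ∉ K R := fun hzK => by
        have := hsub hzK
        simp at this; linarith
      have hz2 : R < ‖H z‖ := by
        by_contra hcon
        exact hzn ⟨by simp [hz, hr1], not_lt.1 hcon⟩
      rw [hH, norm_mul, hz] at hz2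
      nlinarith [norm_nonneg (h z)]) (subset_closure (by simp [hr0]))
    simp [hh0] at this
    exact (one_le_inv₀ hRpos).1 this
  have hstep : ∀ R, 0 ≤ R → Set.InjOn H (K R) → ∃ R', R < R' ∧ Set.InjOn H (K R') := by
    intro R hR hinj
    obtain ⟨r', hr0, hr1, hsub⟩ := hradius R hR hinj
    obtain ⟨t, ht1, ht2, ht3⟩ := hinj.exists_isOpen_superset (hcompact R hinj)
      (fun x hx => (hHd.differentiableAt (isOpen_ball.mem_nhds hx.1)).continuousAt) (by
        intro x hx
        have hs : HasStrictDerivAt H (deriv H x) x :=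
          (hHd.analyticAt (isOpen_ball.mem_nhds hx.1)).hasStrictDerivAt
        have hs2 := hs.hasStrictFDerivAt_equiv (hder x hx.1)
        exact ⟨_, (hs2.toOpenPartialHomeomorph _).open_source.mem_nhds hs2.mem_toOpenPartialHomeomorph_source,
          (hs2.toOpenPartialHomeomorph _).injOn⟩)
    have hC : IsCompact (closedBall (0:ℂ) r' \ (t ∩ ball 0 r')) :=
      (isCompact_closedBall _ _).diff (ht1.inter isOpen_ball)
    have hCs : closedBall (0:ℂ) r' \ (t ∩ ball 0 r') ⊆ ball 0 1 :=
      Set.sdiff_subset.trans (closedBall_subset_ball hr1)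
    obtain ⟨w, hw, hmin⟩ := hC.exists_isMinOn ⟨(r':ℂ), by simp [abs_of_pos hr0]⟩
      ((hHd.continuousOn.mono hCs).norm)
    have hwR : R < ‖H w‖ := by
      by_contra hcon
      have : w ∈ K R := ⟨hCs hw, not_lt.1 hcon⟩
      exact hw.2 ⟨ht2 this, hsub this⟩
    refine ⟨(R + ‖H w‖) / 2, by linarith, ht3.mono ?_⟩
    rintro z ⟨hz1, hz2⟩
    have hzr : ‖z‖ < r' := by
      by_contra hcon
      obtain ⟨z2, h1, h2⟩ := hmono z hz1 r' hr0.le (not_lt.1 hcon)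
      have : ‖H w‖ ≤ ‖H z2‖ := hmin (show z2 ∈ _ from ⟨by simp [h1], by simp [h1]⟩)
      linarith
    by_contra hzt
    have : ‖H w‖ ≤ ‖H z‖ := hmin (show z ∈ _ from ⟨by simp [hzr.le], fun hh => hzt hh.1⟩)
    linarith
  set S : Set ℝ := {R | 0 ≤ R ∧ Set.InjOn H (K R)} with hS
  have h0S : (0:ℝ) ∈ S := by
    refine ⟨le_rfl, ?_⟩
    have : ∀ z ∈ K 0, z = 0 := by
      rintro z ⟨hz, hz2⟩
      have : H z = 0 := by simpa using hz2
      rw [hH] at this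
      exact (mul_eq_zero.1 this).resolve_right (hhne z hz)
    intro x hx y hy _
    rw [this x hx, this y hy]
  have hbdd : BddAbove S := ⟨1, fun R hR => hle R hR.1 hR.2⟩
  have hsup0 : 0 ≤ sSup S := le_csSup hbdd h0S
  have hsupS : Set.InjOn H (K (sSup S)) := by
    rcases hsup0.eq_or_lt with h0 | hpos
    · rw [← h0]; exact h0S.2
    intro z hz z' hz' heq
    by_contra hne
    obtain ⟨W, W', hW, hW', hzW, hzW', hdis⟩ := t2_separation hne
    have o1 := hop (W ∩ ball 0 1) Set.inter_subset_right (hW.inter isOpen_ball)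
    have o2 := hop (W' ∩ ball 0 1) Set.inter_subset_right (hW'.inter isOpen_ball)
    have hmem : H z ∈ closure (ball (0:ℂ) (sSup S)) := by
      rw [closure_ball _ hpos.ne']; simpa using hz.2
    obtain ⟨s, hs1, hs2⟩ := mem_closure_iff.1 hmem _ (o1.inter o2)
      ⟨⟨z, ⟨hzW, hz.1⟩, rfl⟩, ⟨z', ⟨hzW', hz'.1⟩, heq.symm⟩⟩
    have hs2' : ‖s‖ < sSup S := by simpa using hs2
    obtain ⟨R, hRS, hR⟩ := exists_lt_of_lt_csSup ⟨0, h0S⟩ hs2'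
    obtain ⟨⟨x, hx, hxs⟩, ⟨x', hx', hxs'⟩⟩ := hs1
    have : x = x' := hRS.2 ⟨hx.2, by rw [hxs]; exact hR.le⟩ ⟨hx'.2, by rw [hxs']; exact hR.le⟩
      (hxs.trans hxs'.symm)
    subst this
    exact Set.disjoint_left.1 hdis hx.1 hx'.1
  obtain ⟨R', h1, h2⟩ := hstep _ hsup0 hsupS
  exact absurd (le_csSup hbdd (show R' ∈ S from ⟨hsup0.trans h1.le, h2⟩)) (not_le.2 h1)

lemma growth (A p m : ℂ → ℂ) (α : ℝ) (hα0 : 0 ≤ α) (hα1 : α < 1)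
    (hA : DifferentiableOn ℂ A (ball 0 1)) (hA0 : A 0 = 0)
    (hp : DifferentiableOn ℂ p (ball 0 1)) (hp0 : p 0 = 1)
    (hpre : ∀ z ∈ ball (0:ℂ) 1, α < (p z).re)
    (hm : ∀ z ∈ ball (0:ℂ) 1, ‖m z‖ ≤ ‖z‖)
    (hv : ∀ z ∈ ball (0:ℂ) 1, 1 + z * deriv A z = p z * (1 / (1 - m z)))
    (z : ℂ) (hz : z ∈ ball (0:ℂ) 1) : -Real.log 2 - (1 - α) ≤ (A z).re := by
  have hre : ∀ z ∈ ball (0:ℂ) 1, α + (1 - α) * ((1 - ‖z‖) / (1 + ‖z‖)) ≤ (p z).re := by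
    intro z hz
    have h1a : (0:ℝ) < 1 - α := by linarith
    have key : ∀ z, ((p z - α) / ((1 - α : ℝ) : ℂ)).re = ((p z).re - α) / (1 - α) := by
      intro z; rw [Complex.div_ofReal_re]; simp
    have := E2 (fun z => (p z - α) / ((1 - α : ℝ) : ℂ)) ((hp.sub_const _).div_const _)
      (by
        simp only [hp0]; push_cast; apply div_self
        norm_cast; exact h1a.ne')
      (by intro z hz; rw [key]; have := hpre z hz; apply div_pos <;> linarith) z hz
    rw [key, le_div_iff₀ h1a] at this
    linarith
  have hV : ∀ ε > 0, 
      0 ≤ (A z).re + (Real.log (1 + ‖z‖) + 2 * (1 - α) * (1 - 1 / (1 + ‖z‖)) + ε * ‖z‖) := by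
    intro ε hε
    have hpos : ∀ z : ℂ, (0:ℝ) < 1 + ‖z‖ := fun z => by positivity
    obtain ⟨z2, h1, h2⟩ := descent (fun z => (A z).re + (Real.log (1 + ‖z‖) +
        2 * (1 - α) * (1 - 1 / (1 + ‖z‖)) + ε * ‖z‖)) (by
      have hAc := hA.continuousOn
      have e1 : ContinuousOn (fun z => (A z).re) (ball 0 1) := Complex.continuous_re.comp_continuousOn hAc
      refine e1.add (Continuous.continuousOn ?_)
      have c1 : Continuous fun z : ℂ => 1 + ‖z‖ := by fun_prop
      have c2 := c1.log (fun z => (hpos z).ne')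
      have c3 := continuous_const (y := (1:ℝ)).div c1 (fun z => (hpos z).ne')
      exact (c2.add (continuous_const.mul (continuous_const.sub c3))).add (continuous_const.mul continuous_norm)) (by
      intro z hz hz0
      have hz1 : ‖z‖ < 1 := by simpa using hz
      have hzp : 0 < ‖z‖ := norm_pos_iff.2 hz0
      have hpr := hpre z hz
      have hpp : 0 < (p z).re := by linarith
      have hpne : p z ≠ 0 := by intro h; rw [h] at hpp; simp at hpp
      have hq : 0 < (1 / p z).re := by
        rw [one_div, Complex.inv_re]; exact div_pos hpp (Complex.normSq_pos.2 hpne)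
      refine ⟨1 / p z, hq, _, ?_, HasDerivAt.add (pathA A z _ (hA.differentiableAt (isOpen_ball.mem_nhds hz)))
        (((((pathN' z (1 / p z)).const_add 1).log ?_).add
          (((((hasDerivAt_const (0:ℝ) (1:ℝ)).div ((pathN' z (1 / p z)).const_add 1) ?_)).const_sub 1).const_mul (2 * (1 - α)))).add
          ((pathN' z (1 / p z)).const_mul ε))⟩
      · have hm1 := E1 _ _ (hm z hz) hz1
        have hE3 := E3 _ hpp
        have hr := hre z hz
        have e : (z * deriv A z * (1 / p z)).re = (1 / (1 - m z)).re - (1 / p z).re := by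
          rw [← Complex.sub_re]; congr 1
          have := hv z hz
          field_simp
          field_simp at this
          linear_combination this
        rw [e]
        simp only [Complex.ofReal_zero, zero_mul, neg_zero, Complex.exp_zero, mul_one, zero_sub]
        set ρ := ‖z‖
        set κ := (1 / p z).re
        set s := (1 / (1 - m z)).re
        have h1 : κ * (α * (1 + ρ) + (1 - α) * (1 - ρ)) ≤ 1 + ρ := by
          have : κ * (p z).re ≤ 1 := by
            rw [le_div_iff₀ hpp] at hE3; exact hE3
          have h3 : κ * (α + (1 - α) * ((1 - ρ) / (1 + ρ))) ≤ 1 := by nlinarith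
          have h4 : κ * (α + (1 - α) * ((1 - ρ) / (1 + ρ))) = κ * (α * (1 + ρ) + (1 - α) * (1 - ρ)) / (1 + ρ) := by
            field_simp
          rw [h4, div_le_one (by positivity)] at h3
          exact h3
        have h2 : κ - ρ * κ / (1 + ρ) - 2 * (1 - α) * (ρ * κ / (1 + ρ) ^ 2) ≤ 1 / (1 + ρ) := by
          have e2 : κ - ρ * κ / (1 + ρ) - 2 * (1 - α) * (ρ * κ / (1 + ρ) ^ 2) =
            κ * (α * (1 + ρ) + (1 - α) * (1 - ρ)) / (1 + ρ) / (1 + ρ) := by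
            field_simp; ring
          rw [e2]
          apply div_le_div_of_nonneg_right _ (by positivity)
          rw [div_le_one (by positivity)]; exact h1
        have h5 : 0 < ε * (ρ * κ) := by positivity
        have e3 : ρ * κ / (1 + ρ) ^ 2 = -(0 * (1 + ρ) - 1 * -(ρ * κ)) / (1 + ρ) ^ 2 * -1 := by ring
        have e4 : -(ρ * κ) / (1 + ρ) = -(ρ * κ / (1 + ρ)) := by ring
        rw [e3] at h2
        rw [e4]
        ring_nf at h2 hm1 h5 ⊢
        linarith
      · simpa using (hpos z).ne'
      · simpa using (hpos z).ne') z hz 0 le_rfl (norm_nonneg _)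
    have : z2 = 0 := by simpa using h1
    subst this
    simpa [hA0] using h2
  have hz1 : ‖z‖ < 1 := by simpa using hz
  have h0 : 0 ≤ (A z).re + (Real.log (1 + ‖z‖) + 2 * (1 - α) * (1 - 1 / (1 + ‖z‖))) := by
    refine le_of_forall_pos_le_add fun ε hε => ?_
    have := hV ε hε
    nlinarith [norm_nonneg z]
  have h1 : Real.log (1 + ‖z‖) ≤ Real.log 2 := Real.log_le_log (by positivity) (by linarith)
  have h2 : 1 / 2 ≤ 1 / (1 + ‖z‖) := by
    apply one_div_le_one_div_of_le (by positivity); linarith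
  nlinarith

lemma coefs (a : ℕ → ℂ) (hs : ∀ z ∈ ball (0:ℂ) 1, Summable (fun n => a n * z ^ n))
    (p m : ℂ → ℂ) (α : ℝ) (hα1 : α < 1)
    (hp : DifferentiableOn ℂ p (ball 0 1)) (hp0 : p 0 = 1)
    (hpre : ∀ z ∈ ball (0:ℂ) 1, α < (p z).re)
    (hmd : DifferentiableOn ℂ m (ball 0 1))
    (hm : ∀ z ∈ ball (0:ℂ) 1, ‖m z‖ ≤ ‖z‖)
    (hv : ∀ z ∈ ball (0:ℂ) 1, 1 + z * deriv (fun z => ∑' n, a n * z ^ n) z = p z * (1 / (1 - m z)))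
    (n : ℕ) (hn : n ≠ 0) : n * ‖a n‖ ≤ 1 + 2 * (1 - α) * n := by
  have hb : ball (0:ℂ) 1 ∈ nhds (0:ℂ) := isOpen_ball.mem_nhds (by simp)
  have h1a : (0:ℝ) < 1 - α := by linarith
  have hm0 : m 0 = 0 := by simpa using hm 0 (by simp)
  have hmne : ∀ z ∈ ball (0:ℂ) 1, 1 - m z ≠ 0 := by
    intro z hz h
    have h1 := hm z hz
    have : m z = 1 := by linear_combination -h
    rw [this] at h1; simp at hz h1; linarith
  have hcd : DifferentiableOn ℂ (fun z => 1 / (1 - m z)) (ball 0 1) :=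
    (differentiableOn_const _).div (hmd.const_sub 1) hmne
  have hpa : AnalyticAt ℂ p 0 := hp.analyticAt hb
  have hca : AnalyticAt ℂ (fun z => 1 / (1 - m z)) 0 := hcd.analyticAt hb
  have hpk : ∀ n : ℕ, n ≠ 0 → ‖iteratedDeriv n p 0 / n.factorial‖ ≤ 2 * (1 - α) := by
    intro n hn
    have key : ∀ z, ((((1 - α)⁻¹ : ℝ) : ℂ) * (p z - α)).re = (1 - α)⁻¹ * ((p z).re - α) := by
      intro z; rw [Complex.re_ofReal_mul]; simp
    have := cara_s7 (fun z => (((1 - α)⁻¹ : ℝ) : ℂ) * (p z - α)) ((hp.sub_const _).const_mul _)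
      (by
        simp only [hp0]; push_cast; apply inv_mul_cancel₀
        norm_cast; exact h1a.ne')
      (by intro z hz; rw [key]; have := hpre z hz; apply mul_pos (inv_pos.2 h1a); linarith) n hn
    rw [iteratedDeriv_const_mul _ (by exact (hpa.sub analyticAt_const).contDiffAt)] at this
    have e : iteratedDeriv n (fun z => p z - (α:ℂ)) 0 = iteratedDeriv n p 0 := by
      simp only [sub_eq_neg_add]
      rw [iteratedDeriv_const_add (Nat.pos_of_ne_zero hn)]
    rw [e, mul_div_assoc, norm_mul, Complex.norm_real, Real.norm_of_nonneg (by positivity), inv_mul_le_iff₀ h1a] at this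
    linarith
  have hck : ∀ n : ℕ, ‖iteratedDeriv n (fun z => 1 / (1 - m z)) 0 / n.factorial‖ ≤ 1 := by
    intro n
    by_cases hn : n = 0
    · subst hn; simp [hm0]
    have := cara_s7 (fun z => -1 + 2 * (1 / (1 - m z))) ((hcd.const_mul _).const_add _)
      (by simp [hm0]; norm_num)
      (by
        intro z hz
        have hz1 : ‖z‖ < 1 := by simpa using hz
        have h1 := E1 _ _ (hm z hz) hz1
        have h2 : 1 / 2 < 1 / (1 + ‖z‖) := by
          apply one_div_lt_one_div_of_lt (by positivity); linarith
        have e : (-1 + 2 * (1 / (1 - m z))).re = -1 + 2 * (1 / (1 - m z)).re := by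
          simp
        rw [e]; linarith) n hn
    rw [iteratedDeriv_const_add (Nat.pos_of_ne_zero hn),
      iteratedDeriv_const_mul _ (by exact hca.contDiffAt), mul_div_assoc, norm_mul] at this
    simp only [Complex.norm_two] at this
    linarith
  have h3 := coef_mul p (fun z => 1 / (1 - m z)) hpa hca (2 * (1 - α)) hp0 hpk hck n
  have hAa := (psA a hs).analyticAt
  have e1 : (fun z => p z * (1 / (1 - m z))) =ᶠ[nhds 0]
      (fun z => 1 + z * deriv (fun z => ∑' n, a n * z ^ n) z) := by
    filter_upwards [hb] with z hz
    exact (hv z hz).symm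
  rw [e1.iteratedDeriv_eq, iter_zderiv _ hAa n hn, mul_div_assoc, iterA a hs] at h3
  simpa using h3

lemma mono (A p m : ℂ → ℂ)
    (hA : DifferentiableOn ℂ A (ball 0 1))
    (hpre : ∀ z ∈ ball (0:ℂ) 1, 0 < (p z).re)
    (hm : ∀ z ∈ ball (0:ℂ) 1, ‖m z‖ ≤ ‖z‖)
    (hv : ∀ z ∈ ball (0:ℂ) 1, 1 + z * deriv A z = p z * (1 / (1 - m z)))
    (z : ℂ) (hz : z ∈ ball (0:ℂ) 1) (ρ : ℝ) (hρ0 : 0 ≤ ρ) (hρ : ρ ≤ ‖z‖) :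
    ∃ z2 : ℂ, ‖z2‖ = ρ ∧ ‖z2‖ * Real.exp (A z2).re ≤ ‖z‖ * Real.exp (A z).re := by
  refine descent (fun z => ‖z‖ * Real.exp (A z).re) ?_ ?_ z hz ρ hρ0 hρ
  · have e1 : ContinuousOn (fun z => (A z).re) (ball 0 1) :=
      Complex.continuous_re.comp_continuousOn hA.continuousOn
    exact continuous_norm.continuousOn.mul (Real.continuous_exp.comp_continuousOn e1)
  · intro z hz hz0
    have hz1 : ‖z‖ < 1 := by simpa using hz
    have hzp : 0 < ‖z‖ := norm_pos_iff.2 hz0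
    have hpp := hpre z hz
    have hpne : p z ≠ 0 := by intro h; rw [h] at hpp; simp at hpp
    have hq : 0 < (1 / p z).re := by
      rw [one_div, Complex.inv_re]; exact div_pos hpp (Complex.normSq_pos.2 hpne)
    refine ⟨1 / p z, hq, _, ?_, (pathN' z (1 / p z)).mul
      (pathA A z _ (hA.differentiableAt (isOpen_ball.mem_nhds hz))).exp⟩
    have hm1 := E1 _ _ (hm z hz) hz1
    have hs : 0 < (1 / (1 - m z)).re := lt_of_lt_of_le (by positivity) hm1
    have e : (z * deriv A z * (1 / p z)).re = (1 / (1 - m z)).re - (1 / p z).re := by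
      rw [← Complex.sub_re]; congr 1
      have := hv z hz
      field_simp
      field_simp at this
      linear_combination this
    rw [e]
    simp only [Complex.ofReal_zero, zero_mul, neg_zero, Complex.exp_zero, mul_one]
    have : 0 < ‖z‖ * Real.exp (A z).re * (1 / (1 - m z)).re := by positivity
    linarith

lemma final (H : ℂ → ℂ) (c : ℝ) (hc : 0 < c) (hH0 : H 0 = 0) (hHc : ContinuousOn H (ball 0 1))
    (hop : ∀ s ⊆ ball (0:ℂ) 1, IsOpen s → IsOpen (H '' s))
    (hns : ∃ y, y ∉ H '' ball 0 1)
    (hlow : ∀ z ∈ ball (0:ℂ) 1, c * ‖z‖ ≤ ‖H z‖) : c ≤ infDist 0 (frontier (H '' ball 0 1)) := by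
  have hopen : IsOpen (H '' ball 0 1) := hop _ subset_rfl isOpen_ball
  have hne : (frontier (H '' ball 0 1)).Nonempty := by
    rw [nonempty_frontier_iff]
    refine ⟨⟨0, 0, by simp, hH0⟩, ?_⟩
    obtain ⟨y, hy⟩ := hns
    intro h; rw [h] at hy; simp at hy
  rw [le_infDist hne]
  intro y hy
  rw [dist_zero_left]
  by_contra hlt
  push Not at hlt
  obtain ⟨ρ, h1, h2⟩ := exists_between ((div_lt_one hc).2 hlt)
  have h3 : ‖y‖ < c * ρ := by rw [div_lt_iff₀ hc] at h1; linarith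
  have hcl : closure (H '' ball 0 1) ⊆ H '' closedBall 0 ρ ∪ {w | c * ρ ≤ ‖w‖} := by
    apply closure_minimal
    · rintro _ ⟨z, hz, rfl⟩
      by_cases h : ‖z‖ ≤ ρ
      · left; exact ⟨z, by simpa using h, rfl⟩
      · right
        push Not at h
        refine le_trans ?_ (hlow z hz)
        gcongr
    · apply IsClosed.union
      · exact ((isCompact_closedBall _ _).image_of_continuousOn
          (hHc.mono (closedBall_subset_ball h2))).isClosed
      · exact isClosed_le continuous_const continuous_norm
  rw [hopen.frontier_eq] at hy
  rcases hcl hy.1 with h | h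
  · exact hy.2 (Set.image_mono (closedBall_subset_ball h2) h)
  · simp at h; linarith


/-- Bohr-type inequality for `H(z) = z h(z)`: if `0 ≤ r < 1` satisfies
`(r/(1-r)) exp(2(1-α)r/(1-r)) ≤ 1/(2 e^{1-α})`, then
`r exp(Σ_{n≥1} |aₙ| rⁿ) ≤ d(0, ∂ H(𝔻))`. -/
theorem stmt_7 (α : ℝ) (hα0 : 0 ≤ α) (hα1 : α < 1)
    (h g : ℂ → ℂ)
    (hh : DifferentiableOn ℂ h (ball 0 1))
    (hg : DifferentiableOn ℂ g (ball 0 1))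
    (hh0 : h 0 = 1) (hg0 : g 0 = 1)
    (hhne : ∀ z ∈ ball (0:ℂ) 1, h z ≠ 0)
    (hgne : ∀ z ∈ ball (0:ℂ) 1, g z ≠ 0)
    (hsp : ∀ z ∈ ball (0:ℂ) 1,
      ‖z * deriv g z / g z‖ < ‖1 + z * deriv h z / h z‖)
    (hinj : Set.InjOn (fun z => z * h z * (starRingEnd ℂ) (g z)) (ball 0 1))
    (hstar : ∀ z ∈ ball (0:ℂ) 1, z ≠ 0 →
      α < (1 + z * deriv h z / h z - (starRingEnd ℂ) (z * deriv g z / g z)).re)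
    (a : ℕ → ℂ) (ha0 : a 0 = 0)
    (hha : ∀ z ∈ ball (0:ℂ) 1, ∃ w : ℂ,
      HasSum (fun n => a n * z ^ n) w ∧ h z = Complex.exp w)
    (r : ℝ) (hr0 : 0 ≤ r) (hr1 : r < 1)
    (hrle : r / (1 - r) * Real.exp (2 * (1 - α) * r / (1 - r)) ≤
      1 / (2 * Real.exp (1 - α))) :
    r * Real.exp (∑' n : ℕ, ‖a n‖ * r ^ n) ≤
      infDist 0 (frontier ((fun z => z * h z) '' ball 0 1)) := by
  classical
  set A : ℂ → ℂ := fun z => ∑' n, a n * z ^ n with hAdef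
  have hs : ∀ z ∈ ball (0:ℂ) 1, Summable (fun n => a n * z ^ n) := by
    intro z hz
    obtain ⟨w, hw, -⟩ := hha z hz
    exact hw.summable
  have hhA : ∀ z ∈ ball (0:ℂ) 1, h z = Complex.exp (A z) := by
    intro z hz
    obtain ⟨w, hw, h1⟩ := hha z hz
    rw [h1, ← hw.tsum_eq]
  have hAan : ∀ z ∈ ball (0:ℂ) 1, AnalyticAt ℂ A z := by
    intro z hz
    refine (psA a hs).analyticAt_of_mem ?_
    simpa [← ofReal_norm, enorm, ← NNReal.coe_lt_coe] using hz
  have hAd : DifferentiableOn ℂ A (ball 0 1) :=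
    fun z hz => (hAan z hz).differentiableAt.differentiableWithinAt
  have hA0 : A 0 = 0 := by
    have : A 0 = ∑' n, a n * (0:ℂ) ^ n := rfl
    rw [this, tsum_eq_single 0]
    · simp [ha0]
    · intro n hn; simp [hn]
  have hdh : ∀ z ∈ ball (0:ℂ) 1, deriv h z = h z * deriv A z := by
    intro z hz
    have e : h =ᶠ[nhds z] fun z => Complex.exp (A z) := by
      filter_upwards [isOpen_ball.mem_nhds hz] with w hw
      exact hhA w hw
    rw [e.deriv_eq, (hAan z hz).differentiableAt.hasDerivAt.cexp.deriv, hhA z hz]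
  have hvA : ∀ z ∈ ball (0:ℂ) 1, 1 + z * deriv h z / h z = 1 + z * deriv A z := by
    intro z hz
    have := hhne z hz
    rw [hdh z hz]; field_simp
  have hhd : DifferentiableOn ℂ (deriv h) (ball 0 1) := hh.deriv isOpen_ball
  have hgd : DifferentiableOn ℂ (deriv g) (ball 0 1) := hg.deriv isOpen_ball
  set v : ℂ → ℂ := fun z => 1 + z * deriv h z / h z with hvdef
  set u : ℂ → ℂ := fun z => z * deriv g z / g z with hudef
  have hvd : DifferentiableOn ℂ v (ball 0 1) :=
    ((differentiableOn_id.mul hhd).div hh hhne).const_add 1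
  have hud : DifferentiableOn ℂ u (ball 0 1) := (differentiableOn_id.mul hgd).div hg hgne
  have huv : ∀ z ∈ ball (0:ℂ) 1, ‖u z‖ < ‖v z‖ := hsp
  have hvne : ∀ z ∈ ball (0:ℂ) 1, v z ≠ 0 := by
    intro z hz
    exact norm_pos_iff.1 (lt_of_le_of_lt (norm_nonneg _) (huv z hz))
  have hu0 : u 0 = 0 := by simp [hudef]
  have hv0 : v 0 = 1 := by simp [hvdef]
  set m : ℂ → ℂ := fun z => u z / v z with hmdef
  have hmd : DifferentiableOn ℂ m (ball 0 1) := hud.div hvd hvne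
  have hm : ∀ z ∈ ball (0:ℂ) 1, ‖m z‖ ≤ ‖z‖ := by
    intro z hz
    refine norm_le_norm_of_mapsTo_ball (R := 1) hmd ?_ (by simp [hmdef, hu0]) (by simpa using hz)
    intro w hw
    simp only [mem_closedBall_zero_iff, hmdef, norm_div]
    exact div_le_one_of_le₀ (huv w hw).le (norm_nonneg _)
  set p : ℂ → ℂ := fun z => v z - u z with hpdef
  have hpd : DifferentiableOn ℂ p (ball 0 1) := hvd.sub hud
  have hp0 : p 0 = 1 := by simp [hpdef, hu0, hv0]
  have hpre : ∀ z ∈ ball (0:ℂ) 1, α < (p z).re := by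
    intro z hz
    by_cases h0 : z = 0
    · rw [h0, hp0]; simpa using hα1
    · have := hstar z hz h0
      rw [Complex.sub_re, Complex.conj_re] at this
      rw [hpdef, Complex.sub_re]; exact this
  have hv : ∀ z ∈ ball (0:ℂ) 1, 1 + z * deriv A z = p z * (1 / (1 - m z)) := by
    intro z hz
    rw [← hvA z hz]
    change v z = (v z - u z) * (1 / (1 - u z / v z))
    have h1 := hvne z hz
    have h2 : v z - u z ≠ 0 := by
      intro h
      have := hpre z hz
      simp only [hpdef] at this
      rw [h] at this; simp at this; linarith
    have h3 : 1 - u z / v z = (v z - u z) / v z := by field_simp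
    rw [h3]; field_simp
  have hco := coefs a hs p m α hα1 hpd hp0 hpre hmd hm hv
  have hgr := growth A p m α hα0 hα1 hAd hA0 hpd hp0 hpre hm hv
  have hmo := mono A p m hAd (fun z hz => lt_of_le_of_lt hα0 (hpre z hz)) hm hv
  have hnh : ∀ z ∈ ball (0:ℂ) 1, ‖h z‖ = Real.exp (A z).re := by
    intro z hz; rw [hhA z hz, Complex.norm_exp]
  have hsr : Summable fun n => ‖a n‖ * r ^ n := by
    have := (hs (r:ℂ) (by simpa [abs_of_nonneg hr0] using hr1)).norm
    simpa [abs_of_nonneg hr0] using this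
  have hsb := sum_bound a ha0 (2 * (1 - α)) r hr0 hr1 hsr hco
  have h1r : 0 < 1 - r := by linarith
  have hup : r * Real.exp (∑' n : ℕ, ‖a n‖ * r ^ n) ≤ 1 / (2 * Real.exp (1 - α)) := by
    refine le_trans ?_ hrle
    calc r * Real.exp (∑' n : ℕ, ‖a n‖ * r ^ n)
        ≤ r * Real.exp (2 * (1 - α) * r / (1 - r) - Real.log (1 - r)) := by gcongr
      _ = _ := by rw [Real.exp_sub, Real.exp_log h1r]; ring
  refine hup.trans ?_
  set H : ℂ → ℂ := fun z => z * h z with hHdef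
  have hHd : DifferentiableOn ℂ H (ball 0 1) := differentiableOn_id.mul hh
  have hder : ∀ z ∈ ball (0:ℂ) 1, deriv H z ≠ 0 := by
    intro z hz
    have hd := (hh.differentiableAt (isOpen_ball.mem_nhds hz)).hasDerivAt
    have : deriv H z = h z * v z := by
      have hHz : HasDerivAt H (1 * h z + z * deriv h z) z := (hasDerivAt_id z).mul hd
      rw [hHz.deriv]
      have := hhne z hz
      simp only [hvdef]; field_simp
    rw [this]
    exact mul_ne_zero (hhne z hz) (hvne z hz)
  have hop : ∀ s ⊆ ball (0:ℂ) 1, IsOpen s → IsOpen (H '' s) := by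
    rcases (hHd.analyticOnNhd isOpen_ball).is_constant_or_isOpen
      (convex_ball (0:ℂ) 1).isPreconnected with ⟨w, hw⟩ | h1
    · exfalso
      have e1 := hw 0 (by simp)
      have hb : (1/2 : ℂ) ∈ ball (0:ℂ) 1 := by simp; norm_num
      have e2 := hw (1/2) hb
      have := hhne _ hb
      rw [← e1] at e2
      simp [hHdef] at e2
      simp at this
      exact this e2
    · exact h1
  refine final H _ (by positivity) (by simp [hHdef]) hHd.continuousOn hop ?_ ?_
  · refine not_surj h H (fun z => rfl) hh hh0 hhne hHd hder hop ?_
    intro z hz ρ h1 h2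
    obtain ⟨z2, h3, h4⟩ := hmo z hz ρ h1 h2
    refine ⟨z2, h3, ?_⟩
    have hz2 : z2 ∈ ball (0:ℂ) 1 := by
      simp at hz ⊢; linarith
    simp only [hHdef, norm_mul]
    rw [hnh z hz, hnh z2 hz2]; exact h4
  · intro z hz
    simp only [hHdef, norm_mul]
    rw [mul_comm, hnh z hz]
    gcongr
    have := Real.exp_le_exp.2 (hgr z hz)
    refine le_trans (le_of_eq ?_) this
    rw [Real.exp_sub (-Real.log 2), Real.exp_neg, Real.exp_log (by norm_num)]
    field_simp
end
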